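/- There exists a constant C > 0 such that for all f₁, f₂ in the class below and each choice ∂_j ∈ {∂_x, ∂_z}, the following hold: (i) ‖f₁ f₂‖_{L²} ≤ C (‖∂_j f₁‖_{H¹} + ‖f₁‖_{H¹}) ‖f₂‖_{L²} + C (‖∂_j f₁‖_{L²} + ‖f₁‖_{L²}) ‖f₂‖_{H¹}; (ii) ‖∂_j(f₁ f₂)‖_{L²} ≤ C (‖∂_j f₁‖_{H¹} + ‖f₁‖_{H¹})(‖∂_j f₂‖_{L²} + ‖f₂‖_{L²}) + C (‖∂_j f₁‖_{L²} + ‖f₁‖_{L²})(‖∂_j f₂‖_{H¹} + ‖f₂‖_{H¹}); (iii) if moreover ∫₀¹ f₁(x,y,z) dx = 0 for all (y,z), then for each k ∈ {1,2,3}: ‖f₁ f₂‖_{H^k} ≤ C ‖∂_x f₁‖_{H^{k+1}} ‖f₂‖_{L²} + C ‖∂_x f₁‖_{L²} ‖f₂‖_{H^{k+1}}. The constant C is independent of f₁, f₂, j, k. -/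

import Mathlib

open MeasureTheory

noncomputable section

/-- Partial derivative in the first variable `x`. -/
def pdx (f : ℝ → ℝ → ℝ → ℂ) : ℝ → ℝ → ℝ → ℂ :=
  fun x y z => deriv (fun x' => f x' y z) x

/-- Partial derivative in the second variable `y`. -/
def pdy (f : ℝ → ℝ → ℝ → ℂ) : ℝ → ℝ → ℝ → ℂ :=
  fun x y z => deriv (fun y' => f x y' z) y

/-- Partial derivative in the third variable `z`. -/
def pdz (f : ℝ → ℝ → ℝ → ℂ) : ℝ → ℝ → ℝ → ℂ :=
  fun x y z => deriv (fun z' => f x y z') z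

/-- Iterated partial derivative `∂^α` for a multi-index `α ∈ ℕ³`. -/
def pderiv3 (α : ℕ × ℕ × ℕ) (f : ℝ → ℝ → ℝ → ℂ) : ℝ → ℝ → ℝ → ℂ :=
  (pdx^[α.1]) ((pdy^[α.2.1]) ((pdz^[α.2.2]) f))

/-- Squared `L²` norm on `Ω = 𝕋 × ℝ × 𝕋` (with periods `1` in `x` and `z`):
`‖f‖_{L²}² = ∫₀¹∫_ℝ∫₀¹ |f(x,y,z)|² dx dy dz`. -/
def L2sq (f : ℝ → ℝ → ℝ → ℂ) : ℝ :=
  ∫ x in Set.Ioc (0:ℝ) 1, ∫ y : ℝ, ∫ z in Set.Ioc (0:ℝ) 1, ‖f x y z‖ ^ 2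

/-- `L²` norm on `Ω = 𝕋 × ℝ × 𝕋`. -/
def L2norm (f : ℝ → ℝ → ℝ → ℂ) : ℝ :=
  Real.sqrt (L2sq f)

/-- The multi-indices `α ∈ ℕ³` of order `|α| ≤ N`. -/
def multiIndicesLe (N : ℕ) : Finset (ℕ × ℕ × ℕ) :=
  (Finset.range (N+1) ×ˢ Finset.range (N+1) ×ˢ Finset.range (N+1)).filter
    fun α => α.1 + α.2.1 + α.2.2 ≤ N

/-- Squared `H^N` norm: `‖f‖_{H^N}² = Σ_{|α| ≤ N} ‖∂^α f‖_{L²}²`. -/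
def HNsq (N : ℕ) (f : ℝ → ℝ → ℝ → ℂ) : ℝ :=
  ∑ α ∈ multiIndicesLe N, L2sq (pderiv3 α f)

/-- `H^N` norm. -/
def HN (N : ℕ) (f : ℝ → ℝ → ℝ → ℂ) : ℝ :=
  Real.sqrt (HNsq N f)

/-- `L²` norm of the gradient: `‖∇f‖_{L²}² = ‖∂_x f‖² + ‖∂_y f‖² + ‖∂_z f‖²`. -/
def gradL2norm (f : ℝ → ℝ → ℝ → ℂ) : ℝ :=
  Real.sqrt (L2sq (pdx f) + L2sq (pdy f) + L2sq (pdz f))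

/-- The Laplacian `Δ = ∂_x² + ∂_y² + ∂_z²`. -/
def lap (f : ℝ → ℝ → ℝ → ℂ) : ℝ → ℝ → ℝ → ℂ :=
  pdx (pdx f) + pdy (pdy f) + pdz (pdz f)

/-- The operator `∂_x² + ∂_z²`. -/
def dxxzz (f : ℝ → ℝ → ℝ → ℂ) : ℝ → ℝ → ℝ → ℂ :=
  pdx (pdx f) + pdz (pdz f)

/-- The class of smooth functions `f : ℝ³ → ℂ` which are `1`-periodic in `x` and in `z`
and, together with all partial derivatives, decay faster than any polynomial as
`|y| → ∞`. -/
structure GoodFn (f : ℝ → ℝ → ℝ → ℂ) : Prop where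
  smooth : ContDiff ℝ (⊤ : ℕ∞) (fun p : ℝ × ℝ × ℝ => f p.1 p.2.1 p.2.2)
  per_x : ∀ x y z, f (x + 1) y z = f x y z
  per_z : ∀ x y z, f x y (z + 1) = f x y z
  decay : ∀ (α : ℕ × ℕ × ℕ) (n : ℕ), ∃ C : ℝ, ∀ x y z : ℝ,
    ‖pderiv3 α f x y z‖ * |y| ^ n ≤ C


/-- Smoothness of a function of three real variables, stated for its uncurried form. -/
def Smooth3 (f : ℝ → ℝ → ℝ → ℂ) : Prop :=
  ContDiff ℝ (⊤ : ℕ∞) (fun p : ℝ × ℝ × ℝ => f p.1 p.2.1 p.2.2)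

/-- The partial derivatives `∂_x, ∂_y, ∂_z`, indexed by `Fin 3`. -/
def pd : Fin 3 → (ℝ → ℝ → ℝ → ℂ) → (ℝ → ℝ → ℝ → ℂ)
  | 0 => pdx
  | 1 => pdy
  | 2 => pdz

/-- The coordinate directions of `ℝ³`. -/
def coordDir : Fin 3 → ℝ × ℝ × ℝ
  | 0 => (1, 0, 0)
  | 1 => (0, 1, 0)
  | 2 => (0, 0, 1)

namespace Smooth3

variable {f g : ℝ → ℝ → ℝ → ℂ}

theorem hasFDerivAt (hf : Smooth3 f) (p : ℝ × ℝ × ℝ) :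
    HasFDerivAt (fun p : ℝ × ℝ × ℝ => f p.1 p.2.1 p.2.2)
      (fderiv ℝ (fun p : ℝ × ℝ × ℝ => f p.1 p.2.1 p.2.2) p) p :=
  (ContDiff.differentiable hf (by simp) p).hasFDerivAt

theorem hasDerivAt_x_fderiv (hf : Smooth3 f) (x y z : ℝ) :
    HasDerivAt (fun x' => f x' y z)
      (fderiv ℝ (fun p : ℝ × ℝ × ℝ => f p.1 p.2.1 p.2.2) (x, y, z) (1, 0, 0)) x :=
  HasFDerivAt.comp_hasDerivAt (f := fun x' => (x', y, z)) x (hf.hasFDerivAt (x, y, z))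
    ((hasDerivAt_id x).prodMk ((hasDerivAt_const x y).prodMk (hasDerivAt_const x z)))

theorem hasDerivAt_y_fderiv (hf : Smooth3 f) (x y z : ℝ) :
    HasDerivAt (fun y' => f x y' z)
      (fderiv ℝ (fun p : ℝ × ℝ × ℝ => f p.1 p.2.1 p.2.2) (x, y, z) (0, 1, 0)) y :=
  HasFDerivAt.comp_hasDerivAt (f := fun y' => (x, y', z)) y (hf.hasFDerivAt (x, y, z))
    ((hasDerivAt_const y x).prodMk ((hasDerivAt_id y).prodMk (hasDerivAt_const y z)))

theorem hasDerivAt_z_fderiv (hf : Smooth3 f) (x y z : ℝ) :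
    HasDerivAt (fun z' => f x y z')
      (fderiv ℝ (fun p : ℝ × ℝ × ℝ => f p.1 p.2.1 p.2.2) (x, y, z) (0, 0, 1)) z :=
  HasFDerivAt.comp_hasDerivAt (f := fun z' => (x, y, z')) z (hf.hasFDerivAt (x, y, z))
    ((hasDerivAt_const z x).prodMk ((hasDerivAt_const z y).prodMk (hasDerivAt_id z)))

theorem hasDerivAt_x (hf : Smooth3 f) (x y z : ℝ) :
    HasDerivAt (fun x' => f x' y z) (pdx f x y z) x :=
  (hf.hasDerivAt_x_fderiv x y z).differentiableAt.hasDerivAt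

theorem hasDerivAt_y (hf : Smooth3 f) (x y z : ℝ) :
    HasDerivAt (fun y' => f x y' z) (pdy f x y z) y :=
  (hf.hasDerivAt_y_fderiv x y z).differentiableAt.hasDerivAt

theorem hasDerivAt_z (hf : Smooth3 f) (x y z : ℝ) :
    HasDerivAt (fun z' => f x y z') (pdz f x y z) z :=
  (hf.hasDerivAt_z_fderiv x y z).differentiableAt.hasDerivAt

theorem pd_eq_fderiv (hf : Smooth3 f) (i : Fin 3) (x y z : ℝ) :
    pd i f x y z =
      fderiv ℝ (fun p : ℝ × ℝ × ℝ => f p.1 p.2.1 p.2.2) (x, y, z) (coordDir i) := by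
  fin_cases i
  · exact (hf.hasDerivAt_x_fderiv x y z).deriv
  · exact (hf.hasDerivAt_y_fderiv x y z).deriv
  · exact (hf.hasDerivAt_z_fderiv x y z).deriv

theorem uncurry_pd (hf : Smooth3 f) (i : Fin 3) :
    (fun p : ℝ × ℝ × ℝ => pd i f p.1 p.2.1 p.2.2) =
      fun p => fderiv ℝ (fun p : ℝ × ℝ × ℝ => f p.1 p.2.1 p.2.2) p (coordDir i) :=
  funext fun p => hf.pd_eq_fderiv i p.1 p.2.1 p.2.2

protected theorem pd (hf : Smooth3 f) (i : Fin 3) : Smooth3 (pd i f) := by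
  unfold Smooth3
  rw [hf.uncurry_pd i]
  exact (ContDiff.fderiv_right hf (by simp)).clm_apply contDiff_const

theorem pd_comm (hf : Smooth3 f) (i j : Fin 3) : pd i (pd j f) = pd j (pd i f) := by
  have key : ∀ (i j : Fin 3) (p : ℝ × ℝ × ℝ), pd i (pd j f) p.1 p.2.1 p.2.2 =
      fderiv ℝ (fderiv ℝ (fun p : ℝ × ℝ × ℝ => f p.1 p.2.1 p.2.2)) p
        (coordDir i) (coordDir j) := by
    intro i j p
    have hd : DifferentiableAt ℝ (fderiv ℝ (fun p : ℝ × ℝ × ℝ => f p.1 p.2.1 p.2.2)) p :=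
      ((ContDiff.fderiv_right (m := 1) hf (by norm_cast)).differentiable (by simp)) p
    rw [(hf.pd j).pd_eq_fderiv i, hf.uncurry_pd j, fderiv_clm_apply hd (by fun_prop)]
    simp
  funext x y z
  have hsym := (ContDiff.contDiffAt (x := (x, y, z)) hf).isSymmSndFDerivAt
    (by rw [minSmoothness_of_isRCLikeNormedField]; exact WithTop.coe_le_coe.mpr le_top)
  exact (key i j (x, y, z)).trans ((hsym _ _).trans (key j i (x, y, z)).symm)

protected theorem add (hf : Smooth3 f) (hg : Smooth3 g) : Smooth3 (f + g) :=
  ContDiff.add hf hg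

protected theorem mul (hf : Smooth3 f) (hg : Smooth3 g) : Smooth3 (f * g) :=
  ContDiff.mul hf hg

theorem pd_add (hf : Smooth3 f) (hg : Smooth3 g) (i : Fin 3) :
    pd i (f + g) = pd i f + pd i g := by
  funext x y z
  fin_cases i
  · exact ((hf.hasDerivAt_x x y z).add (hg.hasDerivAt_x x y z)).deriv
  · exact ((hf.hasDerivAt_y x y z).add (hg.hasDerivAt_y x y z)).deriv
  · exact ((hf.hasDerivAt_z x y z).add (hg.hasDerivAt_z x y z)).deriv

theorem pd_mul (hf : Smooth3 f) (hg : Smooth3 g) (i : Fin 3) :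
    pd i (f * g) = pd i f * g + f * pd i g := by
  funext x y z
  fin_cases i
  · exact ((hf.hasDerivAt_x x y z).mul (hg.hasDerivAt_x x y z)).deriv
  · exact ((hf.hasDerivAt_y x y z).mul (hg.hasDerivAt_y x y z)).deriv
  · exact ((hf.hasDerivAt_z x y z).mul (hg.hasDerivAt_z x y z)).deriv

end Smooth3

/-- Iterated partial derivatives along a list of directions, the head being applied first. -/
def pdList : List (Fin 3) → (ℝ → ℝ → ℝ → ℂ) → (ℝ → ℝ → ℝ → ℂ)
  | [], f => f
  | i :: w, f => pdList w (pd i f)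

theorem pdList_append (v w : List (Fin 3)) (f : ℝ → ℝ → ℝ → ℂ) :
    pdList (v ++ w) f = pdList w (pdList v f) := by
  induction v generalizing f with
  | nil => rfl
  | cons i v ih => exact ih _

theorem pdList_replicate (i : Fin 3) (n : ℕ) (f : ℝ → ℝ → ℝ → ℂ) :
    pdList (List.replicate n i) f = (pd i)^[n] f := by
  induction n generalizing f with
  | zero => rfl
  | succ n ih => exact ih _

namespace Smooth3

variable {f g : ℝ → ℝ → ℝ → ℂ}

theorem pdList_add (hf : Smooth3 f) (hg : Smooth3 g) (w : List (Fin 3)) :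
    pdList w (f + g) = pdList w f + pdList w g := by
  induction w generalizing f g with
  | nil => rfl
  | cons i w ih => rw [pdList, hf.pd_add hg, ih (hf.pd i) (hg.pd i)]; rfl

theorem pdList_pd (hf : Smooth3 f) (i : Fin 3) (w : List (Fin 3)) :
    pdList w (pd i f) = pd i (pdList w f) := by
  induction w generalizing f with
  | nil => rfl
  | cons j w ih => rw [pdList, pdList, hf.pd_comm, ih (hf.pd j)]

theorem pdList_perm (hf : Smooth3 f) {v w : List (Fin 3)} (h : v.Perm w) :
    pdList v f = pdList w f := by
  induction h generalizing f with
  | nil => rfl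
  | cons i _ ih => exact ih (hf.pd i)
  | swap i j l => simp only [pdList, hf.pd_comm]
  | trans _ _ ih₁ ih₂ => exact (ih₁ hf).trans (ih₂ hf)

end Smooth3

theorem pderiv3_eq_pdList (α : ℕ × ℕ × ℕ) (f : ℝ → ℝ → ℝ → ℂ) :
    pderiv3 α f = pdList (List.replicate α.2.2 2 ++
      (List.replicate α.2.1 1 ++ List.replicate α.1 0)) f := by
  simp only [pdList_append, pdList_replicate]
  rfl

/-- The number of occurrences of each direction in a list, as a multi-index. -/
def listIndex (w : List (Fin 3)) : ℕ × ℕ × ℕ := (w.count 0, w.count 1, w.count 2)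

theorem Smooth3.pdList_eq_pderiv3 {f : ℝ → ℝ → ℝ → ℂ} (hf : Smooth3 f) (w : List (Fin 3)) :
    pdList w f = pderiv3 (listIndex w) f := by
  rw [pderiv3_eq_pdList]
  refine hf.pdList_perm (List.perm_iff_count.mpr fun i => ?_)
  fin_cases i <;> simp [listIndex, List.count_append, List.count_replicate]

theorem listIndex_mem {w : List (Fin 3)} {N : ℕ} (h : w.length ≤ N) :
    listIndex w ∈ multiIndicesLe N := by
  have key : w.count 0 + w.count 1 + w.count 2 = w.length := by
    clear h
    induction w with
    | nil => rfl
    | cons i w ih => fin_cases i <;> simp <;> omega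
  simp only [multiIndicesLe, listIndex, Finset.mem_filter, Finset.mem_product, Finset.mem_range]
  omega

/-- Smooth functions, `1`-periodic in `x` and `z`, all of whose iterated partial derivatives are
`O((1 + y²)⁻¹)`. This class is stable under differentiation and products. -/
structure Tame (f : ℝ → ℝ → ℝ → ℂ) : Prop where
  smooth : Smooth3 f
  per_x : ∀ x y z, f (x + 1) y z = f x y z
  per_z : ∀ x y z, f x y (z + 1) = f x y z
  decay : ∀ w : List (Fin 3), ∃ C : ℝ, ∀ x y z : ℝ, ‖pdList w f x y z‖ * (1 + y ^ 2) ≤ C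

theorem GoodFn.tame {f : ℝ → ℝ → ℝ → ℂ} (hf : GoodFn f) : Tame f where
  smooth := hf.smooth
  per_x := hf.per_x
  per_z := hf.per_z
  decay w := by
    obtain ⟨A, hA⟩ := hf.decay (listIndex w) 0
    obtain ⟨B, hB⟩ := hf.decay (listIndex w) 2
    refine ⟨A + B, fun x y z => ?_⟩
    have h₁ := hA x y z
    have h₂ := hB x y z
    rw [Smooth3.pdList_eq_pderiv3 hf.smooth]
    rw [pow_zero, mul_one] at h₁
    rw [sq_abs] at h₂
    linarith

namespace Tame

variable {f g : ℝ → ℝ → ℝ → ℂ}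

protected theorem pd (hf : Tame f) (i : Fin 3) : Tame (pd i f) where
  smooth := hf.smooth.pd i
  per_x x y z := by
    fin_cases i
    · simp only [pd, pdx]
      rw [← deriv_comp_add_const]
      simp only [hf.per_x]
    · simp only [pd, pdy, hf.per_x]
    · simp only [pd, pdz, hf.per_x]
  per_z x y z := by
    fin_cases i
    · simp only [pd, pdx, hf.per_z]
    · simp only [pd, pdy, hf.per_z]
    · simp only [pd, pdz]
      rw [← deriv_comp_add_const]
      simp only [hf.per_z]
  decay w := hf.decay (i :: w)

protected theorem pdList (hf : Tame f) (w : List (Fin 3)) : Tame (pdList w f) := by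
  induction w generalizing f with
  | nil => exact hf
  | cons i w ih => exact ih (hf.pd i)

theorem decay_mul (hf : Tame f) (hg : Tame g) (w : List (Fin 3)) :
    ∃ C : ℝ, ∀ x y z : ℝ, ‖pdList w (f * g) x y z‖ * (1 + y ^ 2) ≤ C := by
  induction w generalizing f g with
  | nil =>
    obtain ⟨A, hA⟩ := hf.decay []
    obtain ⟨B, hB⟩ := hg.decay []
    refine ⟨A * B, fun x y z => ?_⟩
    have h₁ := hA x y z
    have h₂ := hB x y z
    simp only [pdList, Pi.mul_apply, norm_mul] at h₁ h₂ ⊢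
    have h₃ : ‖f x y z‖ ≤ A := by
      nlinarith [norm_nonneg (f x y z), mul_nonneg (norm_nonneg (f x y z)) (sq_nonneg y)]
    rw [mul_assoc]
    exact mul_le_mul h₃ h₂ (by positivity) ((norm_nonneg _).trans h₃)
  | cons i w ih =>
    obtain ⟨A, hA⟩ := ih (hf.pd i) hg
    obtain ⟨B, hB⟩ := ih hf (hg.pd i)
    refine ⟨A + B, fun x y z => ?_⟩
    rw [pdList, hf.smooth.pd_mul hg.smooth, ((hf.smooth.pd i).mul hg.smooth).pdList_add
      (hf.smooth.mul (hg.smooth.pd i))]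
    have h := norm_add_le (pdList w (pd i f * g) x y z) (pdList w (f * pd i g) x y z)
    have h₁ := hA x y z
    have h₂ := hB x y z
    simp only [Pi.add_apply] at h ⊢
    nlinarith [sq_nonneg y]

protected theorem mul (hf : Tame f) (hg : Tame g) : Tame (f * g) where
  smooth := hf.smooth.mul hg.smooth
  per_x x y z := by simp [hf.per_x, hg.per_x]
  per_z x y z := by simp [hf.per_z, hg.per_z]
  decay := hf.decay_mul hg

protected theorem add (hf : Tame f) (hg : Tame g) : Tame (f + g) where
  smooth := hf.smooth.add hg.smooth
  per_x x y z := by simp [hf.per_x, hg.per_x]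
  per_z x y z := by simp [hf.per_z, hg.per_z]
  decay w := by
    obtain ⟨A, hA⟩ := hf.decay w
    obtain ⟨B, hB⟩ := hg.decay w
    refine ⟨A + B, fun x y z => ?_⟩
    rw [hf.smooth.pdList_add hg.smooth]
    have h := norm_add_le (pdList w f x y z) (pdList w g x y z)
    have h₁ := hA x y z
    have h₂ := hB x y z
    simp only [Pi.add_apply] at h ⊢
    nlinarith [sq_nonneg y]

end Tame

section OneVariable

open scoped ENNReal

/-- `2ab ≤ a² + b²` for extended nonnegative reals. -/
theorem ennreal_two_mul_le_add_sq (a b : ℝ≥0∞) : 2 * a * b ≤ a ^ 2 + b ^ 2 := by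
  induction a with
  | top => simp
  | coe a =>
    induction b with
    | top => simp
    | coe b => exact_mod_cast two_mul_le_add_sq a b

/-- The Cauchy–Schwarz inequality for lower Lebesgue integrals, in squared form. -/
theorem lintegral_mul_sq_le {X : Type*} [MeasurableSpace X] {μ : Measure X} {F G : X → ℝ≥0∞}
    (hF : AEMeasurable F μ) (hG : AEMeasurable G μ) :
    (∫⁻ a, F a * G a ∂μ) ^ 2 ≤ (∫⁻ a, F a ^ 2 ∂μ) * ∫⁻ a, G a ^ 2 ∂μ := by
  have h := ENNReal.lintegral_mul_le_Lp_mul_Lq μ Real.HolderConjugate.two_two hF hG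
  have hs : ∀ c : ℝ≥0∞, (c ^ (1 / 2 : ℝ)) ^ 2 = c := fun c => by
    rw [← ENNReal.rpow_natCast, ← ENNReal.rpow_mul]; norm_num
  calc (∫⁻ a, F a * G a ∂μ) ^ 2
      ≤ ((∫⁻ a, F a ^ (2 : ℝ) ∂μ) ^ (1 / 2 : ℝ) *
          (∫⁻ a, G a ^ (2 : ℝ) ∂μ) ^ (1 / 2 : ℝ)) ^ 2 := by gcongr; exact h
    _ = _ := by rw [mul_pow, hs, hs]; simp only [ENNReal.rpow_two]

theorem enorm_sub_le_lintegral_deriv {E : Type*} [NormedAddCommGroup E] [NormedSpace ℝ E]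
    [CompleteSpace E] {φ φ' : ℝ → E} (hφ : ∀ t, HasDerivAt φ (φ' t) t) (hφ' : Continuous φ')
    {S : Set ℝ} {s t : ℝ} (hS : Set.uIoc t s ⊆ S) :
    ‖φ s - φ t‖ₑ ≤ ∫⁻ u in S, ‖φ' u‖ₑ := by
  rw [← intervalIntegral.integral_eq_sub_of_hasDerivAt (fun u _ => hφ u)
    (hφ'.intervalIntegrable _ _)]
  have h : ‖∫ u in t..s, φ' u‖ₑ = ‖∫ u in Set.uIoc t s, φ' u‖ₑ := by
    simp only [enorm_eq_iff_norm_eq, intervalIntegral.norm_intervalIntegral_eq]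
  rw [h]
  exact (enorm_integral_le_lintegral_enorm _).trans (lintegral_mono_set hS)

theorem ofReal_norm_sq {E : Type*} [SeminormedAddCommGroup E] (a : E) :
    ENNReal.ofReal (‖a‖ ^ 2) = ‖a‖ₑ ^ 2 := by
  rw [ENNReal.ofReal_pow (norm_nonneg _), ofReal_norm]

variable {φ φ' φ'' : ℝ → ℂ}

theorem enorm_sq_le_add_lintegral (hφ : ∀ t, HasDerivAt φ (φ' t) t) (hφ' : Continuous φ')
    {S : Set ℝ} {s t : ℝ} (hS : Set.uIoc t s ⊆ S) :
    ‖φ s‖ₑ ^ 2 ≤ ‖φ t‖ₑ ^ 2 + ∫⁻ u in S, 2 * ‖φ u‖ₑ * ‖φ' u‖ₑ := by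
  have hc : Continuous φ := continuous_iff_continuousAt.mpr fun t => (hφ t).continuousAt
  have h := enorm_sub_le_lintegral_deriv (φ := fun u => ‖φ u‖ ^ 2)
    (φ' := fun u => 2 * inner ℝ (φ u) (φ' u)) (fun u => (hφ u).norm_sq) (by fun_prop) hS
  have h₁ : ‖φ s‖ₑ ^ 2 ≤ ‖φ t‖ₑ ^ 2 + ‖‖φ s‖ ^ 2 - ‖φ t‖ ^ 2‖ₑ := by
    rw [← ofReal_norm_sq, ← ofReal_norm_sq, ← ofReal_norm,
      ← ENNReal.ofReal_add (by positivity) (by positivity)]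
    refine ENNReal.ofReal_le_ofReal ?_
    linarith [Real.le_norm_self (‖φ s‖ ^ 2 - ‖φ t‖ ^ 2)]
  refine h₁.trans ?_
  gcongr
  refine h.trans (lintegral_mono fun u => ?_)
  rw [enorm_mul, mul_assoc]
  have h₂ : ‖(2 : ℝ)‖ₑ = 2 := by simp [Real.enorm_eq_ofReal_abs]
  rw [h₂]
  gcongr
  rw [← ofReal_norm, ← ofReal_norm, ← ofReal_norm, ← ENNReal.ofReal_mul (norm_nonneg _)]
  exact ENNReal.ofReal_le_ofReal (norm_inner_le_norm _ _)

theorem uIoc_subset_unit {s t : ℝ} (hs : s ∈ Set.Ioc (0 : ℝ) 1) (ht : t ∈ Set.Ioc (0 : ℝ) 1) :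
    Set.uIoc t s ⊆ Set.Ioc (0 : ℝ) 1 :=
  fun _ hu => ⟨(le_min ht.1.le hs.1.le).trans_lt hu.1, hu.2.trans (max_le ht.2 hs.2)⟩

theorem const_le_lintegral_unit {c : ℝ≥0∞} {F : ℝ → ℝ≥0∞}
    (h : ∀ t ∈ Set.Ioc (0 : ℝ) 1, c ≤ F t) : c ≤ ∫⁻ t in Set.Ioc (0 : ℝ) 1, F t := by
  calc c = ∫⁻ _ in Set.Ioc (0 : ℝ) 1, c := by simp
    _ ≤ _ := setLIntegral_mono' measurableSet_Ioc h

/-- The one-dimensional Agmon inequality on the unit interval. -/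
theorem enorm_sq_le_lintegral_unit (hφ : ∀ t, HasDerivAt φ (φ' t) t) (hφ' : Continuous φ')
    {s : ℝ} (hs : s ∈ Set.Ioc (0 : ℝ) 1) :
    ‖φ s‖ₑ ^ 2 ≤ ∫⁻ u in Set.Ioc (0 : ℝ) 1, (‖φ u‖ₑ ^ 2 + 2 * ‖φ u‖ₑ * ‖φ' u‖ₑ) := by
  have hc : Continuous φ := continuous_iff_continuousAt.mpr fun t => (hφ t).continuousAt
  refine (const_le_lintegral_unit fun t ht =>
    enorm_sq_le_add_lintegral hφ hφ' (uIoc_subset_unit hs ht)).trans_eq ?_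
  rw [lintegral_add_left (by fun_prop), lintegral_add_left (by fun_prop)]
  simp

theorem enorm_sq_le_lintegral_unit' (hφ : ∀ t, HasDerivAt φ (φ' t) t) (hφ' : Continuous φ')
    {s : ℝ} (hs : s ∈ Set.Ioc (0 : ℝ) 1) :
    ‖φ s‖ₑ ^ 2 ≤ ∫⁻ u in Set.Ioc (0 : ℝ) 1, (2 * ‖φ u‖ₑ ^ 2 + ‖φ' u‖ₑ ^ 2) := by
  refine (enorm_sq_le_lintegral_unit hφ hφ' hs).trans (lintegral_mono fun u => ?_)
  rw [two_mul (‖φ u‖ₑ ^ 2), add_assoc]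
  gcongr
  exact ennreal_two_mul_le_add_sq _ _

/-- The one-dimensional Agmon inequality on the line. -/
theorem enorm_sq_le_lintegral_line (hφ : ∀ t, HasDerivAt φ (φ' t) t) (hφ' : Continuous φ')
    (h0 : Filter.Tendsto φ Filter.atTop (nhds 0)) (s : ℝ) :
    ‖φ s‖ₑ ^ 2 ≤ ∫⁻ u, 2 * ‖φ u‖ₑ * ‖φ' u‖ₑ := by
  have hlim : Filter.Tendsto (fun t => ‖φ t‖ₑ ^ 2 + ∫⁻ u, 2 * ‖φ u‖ₑ * ‖φ' u‖ₑ) Filter.atTop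
      (nhds (0 + ∫⁻ u, 2 * ‖φ u‖ₑ * ‖φ' u‖ₑ)) := by
    refine Filter.Tendsto.add_const _ ?_
    have := ((ENNReal.continuous_pow 2).comp continuous_enorm).tendsto (0 : ℂ) |>.comp h0
    simpa [Function.comp_def] using this
  rw [zero_add] at hlim
  refine ge_of_tendsto' hlim fun t => ?_
  simpa using enorm_sq_le_add_lintegral hφ hφ' (Set.subset_univ (Set.uIoc t s))

/-- The Poincaré inequality on the unit interval for functions of mean zero. -/
theorem lintegral_enorm_sq_le_of_mean_zero (hφ : ∀ t, HasDerivAt φ (φ' t) t)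
    (hφ' : Continuous φ') (h0 : ∫ t in Set.Ioc (0 : ℝ) 1, φ t = 0) :
    ∫⁻ t in Set.Ioc (0 : ℝ) 1, ‖φ t‖ₑ ^ 2 ≤ ∫⁻ t in Set.Ioc (0 : ℝ) 1, ‖φ' t‖ₑ ^ 2 := by
  have hc : Continuous φ := continuous_iff_continuousAt.mpr fun t => (hφ t).continuousAt
  have hpt : ∀ s ∈ Set.Ioc (0 : ℝ) 1, ‖φ s‖ₑ ≤ ∫⁻ u in Set.Ioc (0 : ℝ) 1, ‖φ' u‖ₑ := by
    intro s hs
    have h₁ : φ s = ∫ t in Set.Ioc (0 : ℝ) 1, (φ s - φ t) := by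
      rw [integral_sub (integrable_const _) (hc.integrableOn_Ioc), h0]
      simp
    rw [h₁]
    refine (enorm_integral_le_lintegral_enorm _).trans ?_
    calc ∫⁻ t in Set.Ioc (0 : ℝ) 1, ‖φ s - φ t‖ₑ
        ≤ ∫⁻ _ in Set.Ioc (0 : ℝ) 1, ∫⁻ u in Set.Ioc (0 : ℝ) 1, ‖φ' u‖ₑ :=
          setLIntegral_mono' measurableSet_Ioc fun t ht =>
            enorm_sub_le_lintegral_deriv hφ hφ' (uIoc_subset_unit hs ht)
      _ = _ := by simp
  have hcs := lintegral_mul_sq_le (μ := volume.restrict (Set.Ioc (0 : ℝ) 1))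
    (F := fun u => ‖φ' u‖ₑ) (G := fun _ => 1) (by fun_prop) (by fun_prop)
  simp only [mul_one, one_pow, lintegral_const, MeasurableSet.univ, Measure.restrict_apply,
    Set.univ_inter, Real.volume_Ioc, sub_zero, ENNReal.ofReal_one] at hcs
  calc ∫⁻ t in Set.Ioc (0 : ℝ) 1, ‖φ t‖ₑ ^ 2
      ≤ ∫⁻ _ in Set.Ioc (0 : ℝ) 1, (∫⁻ u in Set.Ioc (0 : ℝ) 1, ‖φ' u‖ₑ) ^ 2 :=
        setLIntegral_mono' measurableSet_Ioc fun t ht => by gcongr; exact hpt t ht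
    _ = (∫⁻ u in Set.Ioc (0 : ℝ) 1, ‖φ' u‖ₑ) ^ 2 := by simp
    _ ≤ _ := hcs

theorem hasDerivAt_inner_deriv (hφ : ∀ t, HasDerivAt φ (φ' t) t)
    (hφ' : ∀ t, HasDerivAt φ' (φ'' t) t) (t : ℝ) :
    HasDerivAt (fun t => inner ℝ (φ t) (φ' t)) (‖φ' t‖ ^ 2 + inner ℝ (φ t) (φ'' t)) t := by
  have h := (hφ t).inner ℝ (hφ' t)
  rwa [real_inner_self_eq_norm_sq, add_comm] at h

theorem lintegral_deriv_sq_le {μ : Measure ℝ}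
    (h₁ : Integrable (fun t => ‖φ' t‖ ^ 2) μ) (h₂ : Integrable (fun t => inner ℝ (φ t) (φ'' t)) μ)
    (h0 : ∫ t, (‖φ' t‖ ^ 2 + inner ℝ (φ t) (φ'' t)) ∂μ = 0) :
    ∫⁻ t, ‖φ' t‖ₑ ^ 2 ∂μ ≤ ∫⁻ t, ‖φ t‖ₑ * ‖φ'' t‖ₑ ∂μ := by
  rw [integral_add h₁ h₂] at h0
  have h₃ : ∫⁻ t, ‖φ' t‖ₑ ^ 2 ∂μ = ‖∫ t, inner ℝ (φ t) (φ'' t) ∂μ‖ₑ := by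
    rw [eq_neg_of_add_eq_zero_right h0, enorm_neg, ← ofReal_norm, Real.norm_eq_abs,
      abs_of_nonneg (integral_nonneg fun _ => by positivity),
      ofReal_integral_eq_lintegral_ofReal h₁ (.of_forall fun _ => by positivity)]
    simp only [ofReal_norm_sq]
  rw [h₃]
  refine (enorm_integral_le_lintegral_enorm _).trans (lintegral_mono fun t => ?_)
  rw [← ofReal_norm, ← ofReal_norm, ← ofReal_norm, ← ENNReal.ofReal_mul (norm_nonneg _)]
  exact ENNReal.ofReal_le_ofReal (norm_inner_le_norm _ _)

/-- Integration by parts over a period. -/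
theorem lintegral_deriv_sq_le_unit (hφ : ∀ t, HasDerivAt φ (φ' t) t)
    (hφ' : ∀ t, HasDerivAt φ' (φ'' t) t) (hφ'' : Continuous φ'')
    (hp : φ 1 = φ 0) (hp' : φ' 1 = φ' 0) :
    ∫⁻ t in Set.Ioc (0 : ℝ) 1, ‖φ' t‖ₑ ^ 2 ≤
      ∫⁻ t in Set.Ioc (0 : ℝ) 1, ‖φ t‖ₑ * ‖φ'' t‖ₑ := by
  have hc : Continuous φ := continuous_iff_continuousAt.mpr fun t => (hφ t).continuousAt
  have hc' : Continuous φ' := continuous_iff_continuousAt.mpr fun t => (hφ' t).continuousAt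
  refine lintegral_deriv_sq_le (Continuous.integrableOn_Ioc (by fun_prop))
    (Continuous.integrableOn_Ioc (by fun_prop)) ?_
  rw [← intervalIntegral.integral_of_le zero_le_one,
    intervalIntegral.integral_eq_sub_of_hasDerivAt
      (fun t _ => hasDerivAt_inner_deriv hφ hφ' t)
      (Continuous.intervalIntegrable (by fun_prop) _ _), hp, hp', sub_self]

/-- Integration by parts on the line. -/
theorem lintegral_deriv_sq_le_line (hφ : ∀ t, HasDerivAt φ (φ' t) t)
    (hφ' : ∀ t, HasDerivAt φ' (φ'' t) t) (h₁ : Integrable (fun t => ‖φ' t‖ ^ 2))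
    (h₂ : Integrable (fun t => inner ℝ (φ t) (φ'' t)))
    (h₃ : Integrable (fun t => inner ℝ (φ t) (φ' t))) :
    ∫⁻ t, ‖φ' t‖ₑ ^ 2 ≤ ∫⁻ t, ‖φ t‖ₑ * ‖φ'' t‖ₑ :=
  lintegral_deriv_sq_le h₁ h₂ <| integral_eq_zero_of_hasDerivAt_of_integrable
    (hasDerivAt_inner_deriv hφ hφ') (h₁.add h₂) h₃

end OneVariable

section ThreeVariables

open scoped ENNReal

variable {X Y Z : Type*} [MeasurableSpace X] [MeasurableSpace Y] [MeasurableSpace Z]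
  {μ : Measure X} {ν : Measure Y} {ρ : Measure Z} [SFinite ν] [SFinite ρ]

theorem lintegral_prod₃ {F : X → Y → Z → ℝ≥0∞}
    (hF : Measurable fun p : X × Y × Z => F p.1 p.2.1 p.2.2) :
    ∫⁻ p, F p.1 p.2.1 p.2.2 ∂μ.prod (ν.prod ρ) = ∫⁻ x, ∫⁻ y, ∫⁻ z, F x y z ∂ρ ∂ν ∂μ := by
  rw [lintegral_prod _ hF.aemeasurable]
  refine lintegral_congr fun x => ?_
  exact lintegral_prod (fun q : Y × Z => F x q.1 q.2) (hF.comp measurable_prodMk_left).aemeasurable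

theorem lintegral_swap_inner {F : X → Y → Z → ℝ≥0∞}
    (hF : Measurable fun p : X × Y × Z => F p.1 p.2.1 p.2.2) :
    ∫⁻ x, ∫⁻ y, ∫⁻ z, F x y z ∂ρ ∂ν ∂μ = ∫⁻ x, ∫⁻ z, ∫⁻ y, F x y z ∂ν ∂ρ ∂μ :=
  lintegral_congr fun x => lintegral_lintegral_swap
    (f := F x) (hF.comp measurable_prodMk_left).aemeasurable

/-- The Cauchy–Schwarz inequality for iterated integrals in three variables. -/
theorem lintegral_mul_sq_le₃ {F G : X → Y → Z → ℝ≥0∞}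
    (hF : Measurable fun p : X × Y × Z => F p.1 p.2.1 p.2.2)
    (hG : Measurable fun p : X × Y × Z => G p.1 p.2.1 p.2.2) :
    (∫⁻ x, ∫⁻ y, ∫⁻ z, F x y z * G x y z ∂ρ ∂ν ∂μ) ^ 2 ≤
      (∫⁻ x, ∫⁻ y, ∫⁻ z, F x y z ^ 2 ∂ρ ∂ν ∂μ) * ∫⁻ x, ∫⁻ y, ∫⁻ z, G x y z ^ 2 ∂ρ ∂ν ∂μ := by
  rw [← lintegral_prod₃ (hF.mul hG), ← lintegral_prod₃ (hF.pow_const 2),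
    ← lintegral_prod₃ (hG.pow_const 2)]
  exact lintegral_mul_sq_le hF.aemeasurable hG.aemeasurable

variable [SFinite μ]

theorem lintegral_reverse {F : X → Y → Z → ℝ≥0∞}
    (hF : Measurable fun p : X × Y × Z => F p.1 p.2.1 p.2.2) :
    ∫⁻ x, ∫⁻ y, ∫⁻ z, F x y z ∂ρ ∂ν ∂μ = ∫⁻ z, ∫⁻ y, ∫⁻ x, F x y z ∂μ ∂ν ∂ρ := by
  have h₁ : Measurable fun p : Z × X × Y => F p.2.1 p.2.2 p.1 :=
    hF.comp (f := fun p : Z × X × Y => (p.2.1, p.2.2, p.1)) (by fun_prop)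
  have h₂ : Measurable fun p : (X × Z) × Y => F p.1.1 p.2 p.1.2 :=
    hF.comp (f := fun p : (X × Z) × Y => (p.1.1, p.2, p.1.2)) (by fun_prop)
  rw [lintegral_swap_inner hF, lintegral_lintegral_swap h₂.lintegral_prod_right'.aemeasurable,
    lintegral_swap_inner (F := fun z x y => F x y z) h₁]

/-- An anisotropic product estimate: `g` and `g'` are controlled uniformly in the first variable,
`g` is moreover controlled uniformly in the second one, and `h` uniformly in the third one. -/
theorem lintegral_mul_sq_le_of_agmon {g g' h G G' H : X → Y → Z → ℝ≥0∞}
    (hg : Measurable fun p : X × Y × Z => g p.1 p.2.1 p.2.2)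
    (hg' : Measurable fun p : X × Y × Z => g' p.1 p.2.1 p.2.2)
    (hG : Measurable fun p : X × Y × Z => G p.1 p.2.1 p.2.2)
    (hG' : Measurable fun p : X × Y × Z => G' p.1 p.2.1 p.2.2)
    (hH : Measurable fun p : X × Y × Z => H p.1 p.2.1 p.2.2)
    (h₁ : ∀ x y z, g x y z ^ 2 ≤ ∫⁻ y', 2 * g x y' z * g' x y' z ∂ν)
    (h₂ : ∀ x y, ∀ᵐ z ∂ρ, h x y z ^ 2 ≤ ∫⁻ z', H x y z' ∂ρ)
    (h₃ : ∀ᵐ x ∂μ, ∀ y z, g x y z ^ 2 ≤ ∫⁻ x', G x' y z ∂μ)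
    (h₄ : ∀ᵐ x ∂μ, ∀ y z, g' x y z ^ 2 ≤ ∫⁻ x', G' x' y z ∂μ) :
    (∫⁻ x, ∫⁻ y, ∫⁻ z, (g x y z * h x y z) ^ 2 ∂ρ ∂ν ∂μ) ^ 2 ≤
      4 * (∫⁻ x, ∫⁻ y, ∫⁻ z, G x y z ∂ρ ∂ν ∂μ) * (∫⁻ x, ∫⁻ y, ∫⁻ z, G' x y z ∂ρ ∂ν ∂μ) *
        (∫⁻ x, ∫⁻ y, ∫⁻ z, H x y z ∂ρ ∂ν ∂μ) ^ 2 := by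
  set M := 4 * (∫⁻ x, ∫⁻ y, ∫⁻ z, G x y z ∂ρ ∂ν ∂μ) * ∫⁻ x, ∫⁻ y, ∫⁻ z, G' x y z ∂ρ ∂ν ∂μ
    with hM
  have hA : ∀ x, Measurable fun z => ∫⁻ y', 2 * g x y' z * g' x y' z ∂ν := fun x => by
    refine Measurable.lintegral_prod_left (f := fun y z => 2 * g x y z * g' x y z) ?_
    exact ((hg.comp measurable_prodMk_left).const_mul 2).mul (hg'.comp measurable_prodMk_left)
  have hB : Measurable fun p : X × Y => ∫⁻ z', H p.1 p.2 z' ∂ρ := by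
    have : Measurable fun p : (X × Y) × Z => H p.1.1 p.1.2 p.2 :=
      hH.comp (f := fun p : (X × Y) × Z => (p.1.1, p.1.2, p.2)) (by fun_prop)
    exact this.lintegral_prod_right'
  have ha : ∀ᵐ x ∂μ, ∫⁻ z, ∫⁻ y', 2 * g x y' z * g' x y' z ∂ν ∂ρ ≤ M ^ (1 / 2 : ℝ) := by
    filter_upwards [h₃, h₄] with x h₃ h₄
    have mg : Measurable fun q : Z × Y => g x q.2 q.1 :=
      hg.comp (f := fun q : Z × Y => (x, q.2, q.1)) (by fun_prop)
    have mg' : Measurable fun q : Z × Y => g' x q.2 q.1 :=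
      hg'.comp (f := fun q : Z × Y => (x, q.2, q.1)) (by fun_prop)
    have hcs := lintegral_mul_sq_le (μ := ρ.prod ν) (mg.const_mul 2).aemeasurable mg'.aemeasurable
    rw [lintegral_prod _ (by fun_prop), lintegral_prod _ (by fun_prop),
      lintegral_prod _ (by fun_prop)] at hcs
    have hsq : ∀ c : ℝ≥0∞, c = (c ^ 2) ^ (1 / 2 : ℝ) := fun c => by
      rw [← ENNReal.rpow_natCast, ← ENNReal.rpow_mul]; norm_num
    rw [hsq (∫⁻ z, ∫⁻ y', 2 * g x y' z * g' x y' z ∂ν ∂ρ)]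
    gcongr
    refine hcs.trans ?_
    rw [hM, lintegral_reverse hG, lintegral_reverse hG',
      ← lintegral_const_mul' (4 : ℝ≥0∞) _ (by simp)]
    gcongr with z z y
    · rw [← lintegral_const_mul' (4 : ℝ≥0∞) _ (by simp)]
      refine lintegral_mono fun y => ?_
      dsimp only
      rw [mul_pow]
      norm_num only
      gcongr
      exact h₃ y z
    · exact h₄ y z
  have hb : ∀ x, ∫⁻ y, ∫⁻ z, (g x y z * h x y z) ^ 2 ∂ρ ∂ν ≤
      (∫⁻ z, ∫⁻ y', 2 * g x y' z * g' x y' z ∂ν ∂ρ) * ∫⁻ y, ∫⁻ z, H x y z ∂ρ ∂ν := fun x => by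
    have hBx : Measurable fun y => ∫⁻ z', H x y z' ∂ρ := hB.comp measurable_prodMk_left
    rw [← lintegral_const_mul _ hBx]
    refine lintegral_mono fun y => ?_
    rw [← lintegral_mul_const _ (hA x)]
    refine lintegral_mono_ae ?_
    filter_upwards [h₂ x y] with z h₂
    rw [mul_pow]
    exact mul_le_mul' (h₁ x y z) h₂
  have hfin : ∫⁻ x, ∫⁻ y, ∫⁻ z, (g x y z * h x y z) ^ 2 ∂ρ ∂ν ∂μ ≤
      M ^ (1 / 2 : ℝ) * ∫⁻ x, ∫⁻ y, ∫⁻ z, H x y z ∂ρ ∂ν ∂μ := by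
    rw [← lintegral_const_mul _ hB.lintegral_prod_right']
    refine lintegral_mono_ae ?_
    filter_upwards [ha] with x ha
    refine (hb x).trans ?_
    gcongr
  calc _ ≤ (M ^ (1 / 2 : ℝ) * ∫⁻ x, ∫⁻ y, ∫⁻ z, H x y z ∂ρ ∂ν ∂μ) ^ 2 := by gcongr
    _ = _ := by
      rw [mul_pow, ← ENNReal.rpow_natCast (M ^ (1 / 2 : ℝ)), ← ENNReal.rpow_mul]
      norm_num

end ThreeVariables

section Norms

open scoped ENNReal

/-- The squared `L²` norm on `𝕋 × ℝ × 𝕋` as an extended nonnegative real. -/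
def normSq (f : ℝ → ℝ → ℝ → ℂ) : ℝ≥0∞ :=
  ∫⁻ x in Set.Ioc (0:ℝ) 1, ∫⁻ y, ∫⁻ z in Set.Ioc (0:ℝ) 1, ‖f x y z‖ₑ ^ 2

/-- Joint continuity of a function of three real variables. -/
def Continuous3 (f : ℝ → ℝ → ℝ → ℂ) : Prop :=
  Continuous fun p : ℝ × ℝ × ℝ => f p.1 p.2.1 p.2.2

variable {f g : ℝ → ℝ → ℝ → ℂ}

theorem Smooth3.continuous3 (hf : Smooth3 f) : Continuous3 f := ContDiff.continuous hf

namespace Continuous3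

theorem measurable (hf : Continuous3 f) :
    Measurable fun p : ℝ × ℝ × ℝ => ‖f p.1 p.2.1 p.2.2‖ₑ :=
  (Continuous.enorm hf).measurable

theorem measurable_sq (hf : Continuous3 f) :
    Measurable fun p : ℝ × ℝ × ℝ => ‖f p.1 p.2.1 p.2.2‖ₑ ^ 2 :=
  hf.measurable.pow_const 2

theorem slice_x (hf : Continuous3 f) (y z : ℝ) : Continuous fun x => f x y z :=
  Continuous.comp (g := fun p : ℝ × ℝ × ℝ => f p.1 p.2.1 p.2.2) (f := fun x => (x, y, z))
    hf (by fun_prop)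

theorem slice_y (hf : Continuous3 f) (x z : ℝ) : Continuous fun y => f x y z :=
  Continuous.comp (g := fun p : ℝ × ℝ × ℝ => f p.1 p.2.1 p.2.2) (f := fun y => (x, y, z))
    hf (by fun_prop)

theorem slice_z (hf : Continuous3 f) (x y : ℝ) : Continuous fun z => f x y z :=
  Continuous.comp (g := fun p : ℝ × ℝ × ℝ => f p.1 p.2.1 p.2.2) (f := fun z => (x, y, z))
    hf (by fun_prop)

theorem reverse (hf : Continuous3 f) : Continuous3 fun x y z => f z y x :=
  Continuous.comp (g := fun p : ℝ × ℝ × ℝ => f p.1 p.2.1 p.2.2)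
    (f := fun p : ℝ × ℝ × ℝ => (p.2.2, p.2.1, p.1)) hf (by fun_prop)

theorem normSq_reverse (hf : Continuous3 f) : normSq (fun x y z => f z y x) = normSq f :=
  (lintegral_reverse hf.measurable_sq).symm

theorem normSq_eq_lintegral_prod (hf : Continuous3 f) :
    normSq f = ∫⁻ p, ‖f p.1 p.2.1 p.2.2‖ₑ ^ 2
      ∂(volume.restrict (Set.Ioc (0:ℝ) 1)).prod
        (volume.prod (volume.restrict (Set.Ioc (0:ℝ) 1))) :=
  (lintegral_prod₃ (F := fun x y z => ‖f x y z‖ₑ ^ 2) hf.measurable_sq).symm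

theorem lintegral_combination (hf : Continuous3 f) (hg : Continuous3 g) :
    ∫⁻ x in Set.Ioc (0:ℝ) 1, ∫⁻ y, ∫⁻ z in Set.Ioc (0:ℝ) 1,
      (2 * ‖f x y z‖ₑ ^ 2 + ‖g x y z‖ₑ ^ 2) = 2 * normSq f + normSq g := by
  have hf' := hf.measurable_sq
  have hg' := hg.measurable_sq
  rw [hf.normSq_eq_lintegral_prod, hg.normSq_eq_lintegral_prod,
    ← lintegral_prod₃ (F := fun x y z => 2 * ‖f x y z‖ₑ ^ 2 + ‖g x y z‖ₑ ^ 2)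
      ((hf'.const_mul 2).add hg'), lintegral_add_right _ hg', lintegral_const_mul _ hf']

end Continuous3

theorem normSq_add_le (hf : Continuous3 f) (hg : Continuous3 g) :
    normSq (f + g) ≤ 2 * normSq f + 2 * normSq g := by
  have hf' := hf.measurable_sq
  have hg' := hg.measurable_sq
  rw [hf.normSq_eq_lintegral_prod, hg.normSq_eq_lintegral_prod,
    Continuous3.normSq_eq_lintegral_prod (f := f + g) (Continuous.add hf hg),
    ← lintegral_const_mul _ hf', ← lintegral_const_mul _ hg',
    ← lintegral_add_right _ (hg'.const_mul 2)]
  refine lintegral_mono fun p => ?_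
  dsimp only [Pi.add_apply]
  calc ‖f p.1 p.2.1 p.2.2 + g p.1 p.2.1 p.2.2‖ₑ ^ 2
      ≤ (‖f p.1 p.2.1 p.2.2‖ₑ + ‖g p.1 p.2.1 p.2.2‖ₑ) ^ 2 := by
        gcongr; exact enorm_add_le _ _
    _ = ‖f p.1 p.2.1 p.2.2‖ₑ ^ 2 + ‖g p.1 p.2.1 p.2.2‖ₑ ^ 2 +
          2 * ‖f p.1 p.2.1 p.2.2‖ₑ * ‖g p.1 p.2.1 p.2.2‖ₑ := by ring
    _ ≤ ‖f p.1 p.2.1 p.2.2‖ₑ ^ 2 + ‖g p.1 p.2.1 p.2.2‖ₑ ^ 2 +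
          (‖f p.1 p.2.1 p.2.2‖ₑ ^ 2 + ‖g p.1 p.2.1 p.2.2‖ₑ ^ 2) := by
        gcongr; exact ennreal_two_mul_le_add_sq _ _
    _ = _ := by ring

/-- The anisotropic product estimate for functions differentiable in each variable. -/
theorem normSq_mul_sq_le {F F₁ F₂ F₂₁ H H₃ : ℝ → ℝ → ℝ → ℂ}
    (hF : Continuous3 F) (hF₁ : Continuous3 F₁) (hF₂ : Continuous3 F₂) (hF₂₁ : Continuous3 F₂₁)
    (hH : Continuous3 H) (hH₃ : Continuous3 H₃)
    (dF₁ : ∀ x y z, HasDerivAt (fun x => F x y z) (F₁ x y z) x)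
    (dF₂ : ∀ x y z, HasDerivAt (fun y => F x y z) (F₂ x y z) y)
    (dF₂₁ : ∀ x y z, HasDerivAt (fun x => F₂ x y z) (F₂₁ x y z) x)
    (dH₃ : ∀ x y z, HasDerivAt (fun z => H x y z) (H₃ x y z) z)
    (h0 : ∀ x z, Filter.Tendsto (fun y => F x y z) Filter.atTop (nhds 0)) :
    ∃ κ, κ ^ 2 ≤ 4 * (normSq H * normSq H₃) ∧
      normSq (F * H) ^ 2 ≤
        4 * (2 * normSq F + normSq F₁) * (2 * normSq F₂ + normSq F₂₁) * (normSq H + κ) ^ 2 := by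
  refine ⟨∫⁻ x in Set.Ioc (0:ℝ) 1, ∫⁻ y, ∫⁻ z in Set.Ioc (0:ℝ) 1,
    2 * ‖H x y z‖ₑ * ‖H₃ x y z‖ₑ, ?_, ?_⟩
  · refine (lintegral_mul_sq_le₃ (F := fun x y z => 2 * ‖H x y z‖ₑ)
      (G := fun x y z => ‖H₃ x y z‖ₑ) (hH.measurable.const_mul 2) hH₃.measurable).trans_eq ?_
    rw [← lintegral_prod₃ (F := fun x y z => (2 * ‖H x y z‖ₑ) ^ 2)
      ((hH.measurable.const_mul 2).pow_const 2)]
    simp only [mul_pow]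
    rw [lintegral_const_mul _ hH.measurable_sq, ← hH.normSq_eq_lintegral_prod, ← mul_assoc]
    norm_num [normSq]
  · have key := lintegral_mul_sq_le_of_agmon
      (μ := volume.restrict (Set.Ioc (0:ℝ) 1)) (ν := volume)
      (ρ := volume.restrict (Set.Ioc (0:ℝ) 1))
      (g := fun x y z => ‖F x y z‖ₑ) (g' := fun x y z => ‖F₂ x y z‖ₑ)
      (h := fun x y z => ‖H x y z‖ₑ)
      (G := fun x y z => 2 * ‖F x y z‖ₑ ^ 2 + ‖F₁ x y z‖ₑ ^ 2)
      (G' := fun x y z => 2 * ‖F₂ x y z‖ₑ ^ 2 + ‖F₂₁ x y z‖ₑ ^ 2)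
      (H := fun x y z => ‖H x y z‖ₑ ^ 2 + 2 * ‖H x y z‖ₑ * ‖H₃ x y z‖ₑ)
      hF.measurable hF₂.measurable ((hF.measurable_sq.const_mul 2).add hF₁.measurable_sq)
      ((hF₂.measurable_sq.const_mul 2).add hF₂₁.measurable_sq)
      (hH.measurable_sq.add ((hH.measurable.const_mul 2).mul hH₃.measurable))
      (fun x y z => enorm_sq_le_lintegral_line (fun y => dF₂ x y z) (hF₂.slice_y x z)
        (h0 x z) y)
      (fun x y => ae_restrict_of_forall_mem measurableSet_Ioc fun z hz =>
        enorm_sq_le_lintegral_unit (fun z => dH₃ x y z) (hH₃.slice_z x y) hz)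
      (ae_restrict_of_forall_mem measurableSet_Ioc fun x hx y z =>
        enorm_sq_le_lintegral_unit' (fun x => dF₁ x y z) (hF₁.slice_x y z) hx)
      (ae_restrict_of_forall_mem measurableSet_Ioc fun x hx y z =>
        enorm_sq_le_lintegral_unit' (fun x => dF₂₁ x y z) (hF₂₁.slice_x y z) hx)
    rw [hF.lintegral_combination hF₁, hF₂.lintegral_combination hF₂₁,
      ← lintegral_prod₃ (F := fun x y z => ‖H x y z‖ₑ ^ 2 + 2 * ‖H x y z‖ₑ * ‖H₃ x y z‖ₑ)
      (hH.measurable_sq.add ((hH.measurable.const_mul 2).mul hH₃.measurable)),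
      lintegral_add_left hH.measurable_sq, ← hH.normSq_eq_lintegral_prod,
      lintegral_prod₃ (F := fun x y z => 2 * ‖H x y z‖ₑ * ‖H₃ x y z‖ₑ)
        ((hH.measurable.const_mul 2).mul hH₃.measurable)] at key
    simpa only [normSq, Pi.mul_apply, enorm_mul] using key

namespace Tame

theorem continuous3 (hf : Tame f) : Continuous3 f := hf.smooth.continuous3

theorem norm_le (hf : Tame f) : ∃ C : ℝ, 0 ≤ C ∧ ∀ x y z, ‖f x y z‖ ≤ C * (1 + y ^ 2)⁻¹ := by
  obtain ⟨C, hC⟩ := hf.decay []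
  refine ⟨C, le_trans (by positivity) (hC 0 0 0), fun x y z => ?_⟩
  rw [← div_eq_mul_inv, le_div_iff₀ (by positivity)]
  exact hC x y z

theorem tendsto_y (hf : Tame f) (x z : ℝ) :
    Filter.Tendsto (fun y => f x y z) Filter.atTop (nhds 0) := by
  obtain ⟨C, -, hC⟩ := hf.norm_le
  refine squeeze_zero_norm (fun y => hC x y z) ?_
  rw [← mul_zero C]
  refine Filter.Tendsto.const_mul C (tendsto_inv_atTop_zero.comp ?_)
  exact Filter.tendsto_atTop_add_const_left _ _ (Filter.tendsto_pow_atTop two_ne_zero)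

theorem integrable_inner (hf : Tame f) (hg : Tame g) (x z : ℝ) :
    Integrable fun y => (inner ℝ (f x y z) (g x y z) : ℝ) := by
  obtain ⟨A, hA, hfA⟩ := hf.norm_le
  obtain ⟨B, hB, hgB⟩ := hg.norm_le
  have hfc := hf.continuous3.slice_y x z
  have hgc := hg.continuous3.slice_y x z
  refine (integrable_inv_one_add_sq.const_mul (A * B)).mono'
    (Continuous.aestronglyMeasurable (by fun_prop)) (.of_forall fun y => ?_)
  have h₁ : (1 + y ^ 2)⁻¹ ≤ (1 : ℝ) := inv_le_one_of_one_le₀ (by nlinarith [sq_nonneg y])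
  calc ‖(inner ℝ (f x y z) (g x y z) : ℝ)‖ ≤ ‖f x y z‖ * ‖g x y z‖ := norm_inner_le_norm _ _
    _ ≤ (A * (1 + y ^ 2)⁻¹) * (B * 1) := by
        gcongr
        · exact hfA x y z
        · exact (hgB x y z).trans (by gcongr)
    _ = _ := by ring

theorem integrable_norm_sq (hf : Tame f) (x z : ℝ) : Integrable fun y => ‖f x y z‖ ^ 2 := by
  simpa only [real_inner_self_eq_norm_sq] using hf.integrable_inner hf x z

theorem exists_lintegral_z_le (hf : Tame f) : ∃ C : ℝ, ∀ x y,
    ∫⁻ z in Set.Ioc (0:ℝ) 1, ‖f x y z‖ₑ ^ 2 ≤ ENNReal.ofReal (C * (1 + y ^ 2)⁻¹) := by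
  obtain ⟨C, hC, h⟩ := hf.norm_le
  refine ⟨C * C, fun x y => ?_⟩
  calc ∫⁻ z in Set.Ioc (0:ℝ) 1, ‖f x y z‖ₑ ^ 2
      ≤ ∫⁻ _ in Set.Ioc (0:ℝ) 1, ENNReal.ofReal (C * C * (1 + y ^ 2)⁻¹) := by
        refine lintegral_mono fun z => ?_
        dsimp only
        rw [← ofReal_norm_sq]
        refine ENNReal.ofReal_le_ofReal ?_
        have h₁ : (1 + y ^ 2)⁻¹ ≤ (1 : ℝ) := inv_le_one_of_one_le₀ (by nlinarith [sq_nonneg y])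
        calc ‖f x y z‖ ^ 2 = ‖f x y z‖ * ‖f x y z‖ := sq _
          _ ≤ (C * (1 + y ^ 2)⁻¹) * (C * 1) := by
            gcongr
            · exact h x y z
            · exact (h x y z).trans (by gcongr)
          _ = _ := by ring
    _ = _ := by simp

theorem exists_lintegral_yz_le (hf : Tame f) : ∃ M : ℝ≥0∞, M < ∞ ∧ ∀ x,
    ∫⁻ y, ∫⁻ z in Set.Ioc (0:ℝ) 1, ‖f x y z‖ₑ ^ 2 ≤ M := by
  obtain ⟨C, hC⟩ := hf.exists_lintegral_z_le
  exact ⟨_, (integrable_inv_one_add_sq.const_mul C).lintegral_lt_top,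
    fun x => lintegral_mono fun y => hC x y⟩

theorem normSq_ne_top (hf : Tame f) : normSq f ≠ ∞ := by
  obtain ⟨M, hM, h⟩ := hf.exists_lintegral_yz_le
  refine ((lintegral_mono fun x => h x).trans_lt ?_).ne
  simpa using hM

theorem L2sq_eq (hf : Tame f) : L2sq f = (normSq f).toReal := by
  have h₁ : ∀ x y, ∫ z in Set.Ioc (0:ℝ) 1, ‖f x y z‖ ^ 2 =
      (∫⁻ z in Set.Ioc (0:ℝ) 1, ‖f x y z‖ₑ ^ 2).toReal := fun x y => by
    have hc := hf.continuous3.slice_z x y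
    rw [integral_eq_lintegral_of_nonneg_ae (.of_forall fun z => by positivity)
      (Continuous.aestronglyMeasurable (by fun_prop))]
    simp only [ofReal_norm_sq]
  obtain ⟨C, hC⟩ := hf.exists_lintegral_z_le
  obtain ⟨M, hM, hM'⟩ := hf.exists_lintegral_yz_le
  have m₁ : Measurable fun p : ℝ × ℝ => ∫⁻ z in Set.Ioc (0:ℝ) 1, ‖f p.1 p.2 z‖ₑ ^ 2 := by
    refine Measurable.lintegral_prod_right (f := fun (p : ℝ × ℝ) z => ‖f p.1 p.2 z‖ₑ ^ 2) ?_
    exact hf.continuous3.measurable_sq.comp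
      (f := fun p : (ℝ × ℝ) × ℝ => (p.1.1, p.1.2, p.2)) (by fun_prop)
  unfold L2sq normSq
  simp only [h₁]
  rw [← integral_toReal m₁.lintegral_prod_right'.aemeasurable
    (.of_forall fun x => (hM' x).trans_lt hM)]
  refine integral_congr_ae (.of_forall fun x => ?_)
  exact integral_toReal (m₁.comp measurable_prodMk_left).aemeasurable
    (.of_forall fun y => (hC x y).trans_lt ENNReal.ofReal_lt_top)

theorem normSq_eq (hf : Tame f) : normSq f = ENNReal.ofReal (L2norm f ^ 2) := by
  rw [L2norm, hf.L2sq_eq, Real.sq_sqrt ENNReal.toReal_nonneg,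
    ENNReal.ofReal_toReal hf.normSq_ne_top]

end Tame

theorem L2norm_nonneg (f : ℝ → ℝ → ℝ → ℂ) : 0 ≤ L2norm f := Real.sqrt_nonneg _

namespace Tame

theorem L2norm_add_le (hf : Tame f) (hg : Tame g) :
    L2norm (f + g) ≤ 2 * (L2norm f + L2norm g) := by
  have h := normSq_add_le hf.continuous3 hg.continuous3
  have hf0 := L2norm_nonneg f
  have hg0 := L2norm_nonneg g
  rw [(hf.add hg).normSq_eq, hf.normSq_eq, hg.normSq_eq, ← ENNReal.ofReal_ofNat,
    ← ENNReal.ofReal_mul (by positivity), ← ENNReal.ofReal_mul (by positivity),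
    ← ENNReal.ofReal_add (by positivity) (by positivity),
    ENNReal.ofReal_le_ofReal_iff (by positivity)] at h
  refine le_of_sq_le_sq ?_ (by positivity)
  nlinarith [mul_nonneg hf0 hg0]

theorem L2norm_pd_sq_le_of_lintegral (hf : Tame f) (i : Fin 3)
    (h : normSq (pd i f) ≤ ∫⁻ x in Set.Ioc (0:ℝ) 1, ∫⁻ y, ∫⁻ z in Set.Ioc (0:ℝ) 1,
      ‖f x y z‖ₑ * ‖pd i (pd i f) x y z‖ₑ) :
    L2norm (pd i f) ^ 2 ≤ L2norm f * L2norm (pd i (pd i f)) := by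
  have hcs := lintegral_mul_sq_le₃ (μ := volume.restrict (Set.Ioc (0:ℝ) 1))
    (ν := volume) (ρ := volume.restrict (Set.Ioc (0:ℝ) 1))
    (F := fun x y z => ‖f x y z‖ₑ) (G := fun x y z => ‖pd i (pd i f) x y z‖ₑ)
    hf.continuous3.measurable ((hf.pd i).pd i).continuous3.measurable
  have h₁ : normSq (pd i f) ^ 2 ≤ normSq f * normSq (pd i (pd i f)) :=
    (pow_le_pow_left' h 2).trans hcs
  rw [(hf.pd i).normSq_eq, hf.normSq_eq, ((hf.pd i).pd i).normSq_eq,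
    ← ENNReal.ofReal_pow (by positivity), ← ENNReal.ofReal_mul (by positivity),
    ENNReal.ofReal_le_ofReal_iff (by positivity), ← mul_pow] at h₁
  exact le_of_sq_le_sq h₁ (mul_nonneg (L2norm_nonneg _) (L2norm_nonneg _))

/-- The interpolation inequality `‖∂_i f‖² ≤ ‖f‖ ‖∂_i² f‖`. -/
theorem L2norm_pd_sq_le (hf : Tame f) (i : Fin 3) :
    L2norm (pd i f) ^ 2 ≤ L2norm f * L2norm (pd i (pd i f)) := by
  refine hf.L2norm_pd_sq_le_of_lintegral i ?_
  have c₁ := (hf.pd i).continuous3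
  have c₂ := ((hf.pd i).pd i).continuous3
  have hm := hf.continuous3.measurable.mul c₂.measurable
  fin_cases i
  · refine (lintegral_reverse c₁.measurable_sq).trans_le (le_trans ?_ (lintegral_reverse
      (F := fun x y z => ‖f x y z‖ₑ * ‖pd 0 (pd 0 f) x y z‖ₑ) hm).ge)
    refine lintegral_mono fun z => lintegral_mono fun y => ?_
    refine lintegral_deriv_sq_le_unit (fun x => hf.smooth.hasDerivAt_x x y z)
      (fun x => (hf.smooth.pd 0).hasDerivAt_x x y z) (c₂.slice_x y z) ?_ ?_
    · simpa using hf.per_x 0 y z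
    · simpa using (hf.pd 0).per_x 0 y z
  · refine (lintegral_swap_inner c₁.measurable_sq).trans_le (le_trans ?_ (lintegral_swap_inner
      (F := fun x y z => ‖f x y z‖ₑ * ‖pd 1 (pd 1 f) x y z‖ₑ) hm).ge)
    refine lintegral_mono fun x => lintegral_mono fun z => ?_
    exact lintegral_deriv_sq_le_line (fun y => hf.smooth.hasDerivAt_y x y z)
      (fun y => (hf.smooth.pd 1).hasDerivAt_y x y z) ((hf.pd 1).integrable_norm_sq x z)
      (hf.integrable_inner ((hf.pd 1).pd 1) x z) (hf.integrable_inner (hf.pd 1) x z)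
  · refine lintegral_mono fun x => lintegral_mono fun y => ?_
    refine lintegral_deriv_sq_le_unit (fun z => hf.smooth.hasDerivAt_z x y z)
      (fun z => (hf.smooth.pd 2).hasDerivAt_z x y z) (c₂.slice_z x y) ?_ ?_
    · simpa using hf.per_z x y 0
    · simpa using (hf.pd 2).per_z x y 0

/-- The Poincaré inequality for functions of mean zero in `x`. -/
theorem L2norm_le_of_mean_zero (hf : Tame f)
    (h0 : ∀ y z : ℝ, (∫ x in Set.Ioc (0:ℝ) 1, f x y z) = 0) :
    L2norm f ≤ L2norm (pd 0 f) := by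
  have h : normSq f ≤ normSq (pd 0 f) := by
    refine (lintegral_reverse hf.continuous3.measurable_sq).trans_le
      (le_trans ?_ (lintegral_reverse (hf.pd 0).continuous3.measurable_sq).ge)
    exact lintegral_mono fun z => lintegral_mono fun y =>
      lintegral_enorm_sq_le_of_mean_zero (fun x => hf.smooth.hasDerivAt_x x y z)
        ((hf.pd 0).continuous3.slice_x y z) (h0 y z)
  rw [hf.normSq_eq, (hf.pd 0).normSq_eq, ENNReal.ofReal_le_ofReal_iff (by positivity)] at h
  exact le_of_sq_le_sq h (L2norm_nonneg _)

theorem mean_zero_pd (hf : Tame f)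
    (h0 : ∀ y z : ℝ, (∫ x in Set.Ioc (0:ℝ) 1, f x y z) = 0) (i : Fin 3) (y z : ℝ) :
    (∫ x in Set.Ioc (0:ℝ) 1, pd i f x y z) = 0 := by
  have c := hf.continuous3
  have c' := (hf.pd i).continuous3
  obtain ⟨C, hC0, hC⟩ := (hf.pd i).norm_le
  have hb : ∀ x y z, ‖pd i f x y z‖ ≤ C := fun x y z =>
    (hC x y z).trans (mul_le_of_le_one_right hC0
      (inv_le_one_of_one_le₀ (by nlinarith [sq_nonneg y])))
  fin_cases i
  · rw [← intervalIntegral.integral_of_le zero_le_one]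
    refine (intervalIntegral.integral_eq_sub_of_hasDerivAt
      (fun x _ => hf.smooth.hasDerivAt_x x y z)
      ((c'.slice_x y z).intervalIntegrable _ _)).trans ?_
    simpa [sub_eq_zero] using hf.per_x 0 y z
  · have h := (hasDerivAt_integral_of_dominated_loc_of_deriv_le
      (μ := volume.restrict (Set.Ioc (0:ℝ) 1)) (F := fun y x => f x y z)
      (F' := fun y x => pd 1 f x y z) (x₀ := y) (bound := fun _ => C) Filter.univ_mem
      (.of_forall fun y => (c.slice_x y z).aestronglyMeasurable)
      (c.slice_x y z).integrableOn_Ioc (c'.slice_x y z).aestronglyMeasurable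
      (.of_forall fun x y _ => hb x y z) (integrable_const _)
      (.of_forall fun x y _ => hf.smooth.hasDerivAt_y x y z)).2
    simp only [h0] at h
    exact h.unique (hasDerivAt_const y 0)
  · have h := (hasDerivAt_integral_of_dominated_loc_of_deriv_le
      (μ := volume.restrict (Set.Ioc (0:ℝ) 1)) (F := fun z x => f x y z)
      (F' := fun z x => pd 2 f x y z) (x₀ := z) (bound := fun _ => C) Filter.univ_mem
      (.of_forall fun z => (c.slice_x y z).aestronglyMeasurable)
      (c.slice_x y z).integrableOn_Ioc (c'.slice_x y z).aestronglyMeasurable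
      (.of_forall fun x z _ => hb x y z) (integrable_const _)
      (.of_forall fun x z _ => hf.smooth.hasDerivAt_z x y z)).2
    simp only [h0] at h
    exact h.unique (hasDerivAt_const z 0)

theorem mean_zero_pdList (hf : Tame f)
    (h0 : ∀ y z : ℝ, (∫ x in Set.Ioc (0:ℝ) 1, f x y z) = 0) (w : List (Fin 3)) (y z : ℝ) :
    (∫ x in Set.Ioc (0:ℝ) 1, pdList w f x y z) = 0 := by
  induction w generalizing f with
  | nil => exact h0 y z
  | cons i w ih => exact ih (hf.pd i) (hf.mean_zero_pd h0 i)

/-- The anisotropic product estimate, with the roles of `x` and `z` given by `i` and `k`. -/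
theorem normSq_mul_sq_le (hf : Tame f) (hg : Tame g) {i k : Fin 3}
    (hik : i = 0 ∧ k = 2 ∨ i = 2 ∧ k = 0) :
    ∃ κ, κ ^ 2 ≤ 4 * (normSq g * normSq (pd k g)) ∧
      normSq (f * g) ^ 2 ≤ 4 * (2 * normSq f + normSq (pd i f)) *
        (2 * normSq (pd 1 f) + normSq (pd i (pd 1 f))) * (normSq g + κ) ^ 2 := by
  have cf := hf.continuous3
  have cfi := (hf.pd i).continuous3
  have cf1 := (hf.pd 1).continuous3
  have cf1i := ((hf.pd 1).pd i).continuous3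
  have cg := hg.continuous3
  have cgk := (hg.pd k).continuous3
  rcases hik with ⟨rfl, rfl⟩ | ⟨rfl, rfl⟩
  · exact _root_.normSq_mul_sq_le cf cfi cf1 cf1i cg cgk hf.smooth.hasDerivAt_x
      hf.smooth.hasDerivAt_y (hf.smooth.pd 1).hasDerivAt_x hg.smooth.hasDerivAt_z hf.tendsto_y
  · have h := _root_.normSq_mul_sq_le cf.reverse cfi.reverse cf1.reverse cf1i.reverse cg.reverse
      cgk.reverse (fun z y x => hf.smooth.hasDerivAt_z x y z)
      (fun z y x => hf.smooth.hasDerivAt_y x y z)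
      (fun z y x => (hf.smooth.pd 1).hasDerivAt_z x y z)
      (fun z y x => hg.smooth.hasDerivAt_x x y z) (fun z x => hf.tendsto_y x z)
    rw [cf.normSq_reverse, cfi.normSq_reverse, cf1.normSq_reverse, cf1i.normSq_reverse,
      cg.normSq_reverse, cgk.normSq_reverse] at h
    rwa [← (hf.mul hg).continuous3.normSq_reverse]

theorem L2norm_mul_pow_le (hf : Tame f) (hg : Tame g) {i k : Fin 3}
    (hik : i = 0 ∧ k = 2 ∨ i = 2 ∧ k = 0) :
    L2norm (f * g) ^ 4 ≤ 4 * (2 * L2norm f ^ 2 + L2norm (pd i f) ^ 2) *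
      (2 * L2norm (pd 1 f) ^ 2 + L2norm (pd i (pd 1 f)) ^ 2) *
      (L2norm g ^ 2 + 2 * L2norm g * L2norm (pd k g)) ^ 2 := by
  obtain ⟨κ, hκ, h⟩ := hf.normSq_mul_sq_le hg hik
  have hg0 := L2norm_nonneg g
  have hk0 := L2norm_nonneg (pd k g)
  have hκ' : κ ≤ ENNReal.ofReal (2 * L2norm g * L2norm (pd k g)) := by
    refine (ENNReal.pow_le_pow_left_iff two_ne_zero).mp (hκ.trans_eq ?_)
    rw [hg.normSq_eq, (hg.pd k).normSq_eq, ← ENNReal.ofReal_pow (by positivity),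
      ← ENNReal.ofReal_mul (by positivity), ← ENNReal.ofReal_ofNat,
      ← ENNReal.ofReal_mul (by positivity)]
    congr 1
    ring
  replace h := h.trans (mul_le_mul_right (pow_le_pow_left' (add_le_add_right hκ' _) 2) _)
  rw [(hf.mul hg).normSq_eq, hf.normSq_eq, (hf.pd i).normSq_eq, (hf.pd 1).normSq_eq,
    ((hf.pd 1).pd i).normSq_eq, hg.normSq_eq] at h
  rw [← ENNReal.ofReal_ofNat 2, ← ENNReal.ofReal_ofNat 4,
    ← ENNReal.ofReal_add (by positivity) (by positivity),
    ← ENNReal.ofReal_mul (by positivity), ← ENNReal.ofReal_mul (by positivity),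
    ← ENNReal.ofReal_add (by positivity) (by positivity),
    ← ENNReal.ofReal_add (by positivity) (by positivity),
    ← ENNReal.ofReal_mul (by positivity), ← ENNReal.ofReal_mul (by positivity),
    ← ENNReal.ofReal_pow (by positivity), ← ENNReal.ofReal_pow (by positivity),
    ← ENNReal.ofReal_mul (by positivity), ENNReal.ofReal_le_ofReal_iff (by positivity),
    ← pow_mul] at h
  exact h

end Tame

end Norms

theorem L2sq_nonneg (f : ℝ → ℝ → ℝ → ℂ) : 0 ≤ L2sq f :=
  integral_nonneg fun _ => integral_nonneg fun _ => integral_nonneg fun _ => sq_nonneg _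

theorem HN_nonneg (N : ℕ) (f : ℝ → ℝ → ℝ → ℂ) : 0 ≤ HN N f := Real.sqrt_nonneg _

theorem HN_mono {M N : ℕ} (h : M ≤ N) (f : ℝ → ℝ → ℝ → ℂ) : HN M f ≤ HN N f := by
  refine Real.sqrt_le_sqrt (Finset.sum_le_sum_of_subset_of_nonneg (fun α hα => ?_)
    fun α _ _ => L2sq_nonneg _)
  simp only [multiIndicesLe, Finset.mem_filter, Finset.mem_product, Finset.mem_range] at hα ⊢
  omega

theorem card_multiIndicesLe_le (N : ℕ) : (multiIndicesLe N).card ≤ (N + 1) ^ 3 := by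
  refine (Finset.card_filter_le _ _).trans_eq ?_
  simp only [Finset.card_product, Finset.card_range]
  ring

theorem HN_le {f : ℝ → ℝ → ℝ → ℂ} {N : ℕ} {M : ℝ}
    (h : ∀ w : List (Fin 3), w.length ≤ N → L2norm (pdList w f) ≤ M) :
    HN N f ≤ ((N : ℝ) + 1) ^ 3 * M := by
  have hM : 0 ≤ M := (L2norm_nonneg _).trans (h [] (Nat.zero_le _))
  have hN : (1 : ℝ) ≤ ((N : ℝ) + 1) ^ 3 := one_le_pow₀ (by linarith [N.cast_nonneg (α := ℝ)])
  refine Real.sqrt_le_iff.mpr ⟨by positivity, ?_⟩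
  calc HNsq N f ≤ ∑ _ ∈ multiIndicesLe N, M ^ 2 := by
        refine Finset.sum_le_sum fun α hα => ?_
        have hα' := (Finset.mem_filter.mp hα).2
        rw [pderiv3_eq_pdList]
        have := h (List.replicate α.2.2 2 ++ (List.replicate α.2.1 1 ++ List.replicate α.1 0))
          (by simp only [List.length_append, List.length_replicate]; omega)
        exact (Real.sqrt_le_left hM).mp this
    _ = (multiIndicesLe N).card * M ^ 2 := by rw [Finset.sum_const, nsmul_eq_mul]
    _ ≤ ((N : ℝ) + 1) ^ 3 * M ^ 2 := by
        gcongr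
        exact_mod_cast card_multiIndicesLe_le N
    _ ≤ (((N : ℝ) + 1) ^ 3 * M) ^ 2 := by
        rw [mul_pow]
        gcongr
        exact le_self_pow₀ hN two_ne_zero

/-- A weakly log-convex sequence is bounded by its boundary values. -/
theorem le_max_of_log_convex {b : ℕ → ℝ} (hb : ∀ i, 0 ≤ b i) {n : ℕ}
    (h : ∀ i, i + 2 ≤ n → b (i + 1) ^ 2 ≤ b i * b (i + 2)) {i : ℕ} (hi : i ≤ n) :
    b i ≤ max (b 0) (b n) := by
  induction n generalizing i with
  | zero => simp [Nat.le_zero.mp hi]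
  | succ n ih =>
    have ih' := fun {i} => ih (i := i) (fun i hi => h i (by omega))
    rcases hi.eq_or_lt with rfl | hi
    · exact le_max_right _ _
    refine (ih' (Nat.lt_succ_iff.mp hi)).trans (max_le (le_max_left _ _) ?_)
    rcases n with _ | n
    · exact le_max_left _ _
    by_cases h0 : b (n + 1) ≤ b 0
    · exact h0.trans (le_max_left _ _)
    refine le_trans ?_ (le_max_right _ _)
    have h₁ := ih' (i := n) (by omega)
    rw [max_eq_right (not_le.mp h0).le] at h₁
    have h₂ := h n le_rfl
    have h₃ : 0 < b (n + 1) := (hb 0).trans_lt (not_le.mp h0)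
    nlinarith [mul_le_mul_of_nonneg_right h₁ (hb (n + 2))]

theorem le_of_almost_log_convex {a : ℕ → ℝ} (ha : ∀ i, 0 ≤ a i) {n : ℕ} {L : ℝ} (hL : 1 ≤ L)
    (h : ∀ i, i + 2 ≤ n → a (i + 1) ^ 2 ≤ L ^ 2 * (a i * a (i + 2))) {i : ℕ} (hi : i ≤ n) :
    a i ≤ L ^ n ^ 2 * (a 0 + a n) := by
  have hL0 : 0 < L := by linarith
  have key := le_max_of_log_convex (b := fun i => L ^ i ^ 2 * a i)
    (fun i => mul_nonneg (by positivity) (ha i)) (n := n) (fun i hi => ?_) hi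
  · have h₁ : a i ≤ L ^ i ^ 2 * a i := le_mul_of_one_le_left (ha i) (one_le_pow₀ hL)
    have h₂ : L ^ 0 ^ 2 * a 0 ≤ L ^ n ^ 2 * a 0 := by
      gcongr
      · exact ha 0
      · exact Nat.zero_le n
    have h₃ : 0 ≤ L ^ n ^ 2 * a 0 := mul_nonneg (by positivity) (ha 0)
    have h₄ : 0 ≤ L ^ n ^ 2 * a n := mul_nonneg (by positivity) (ha n)
    rw [mul_add]
    exact h₁.trans (key.trans (max_le (by linarith) (by linarith)))
  · calc (L ^ (i + 1) ^ 2 * a (i + 1)) ^ 2 = L ^ (2 * (i + 1) ^ 2) * a (i + 1) ^ 2 := by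
          rw [mul_pow, ← pow_mul, mul_comm 2]
      _ ≤ L ^ (2 * (i + 1) ^ 2) * (L ^ 2 * (a i * a (i + 2))) := by gcongr; exact h i hi
      _ = L ^ i ^ 2 * a i * (L ^ (i + 2) ^ 2 * a (i + 2)) := by ring

namespace Tame

variable {f g : ℝ → ℝ → ℝ → ℂ}

theorem L2norm_pdList_le_HN (hf : Tame f) {w : List (Fin 3)} {N : ℕ} (h : w.length ≤ N) :
    L2norm (pdList w f) ≤ HN N f := by
  rw [hf.smooth.pdList_eq_pderiv3]
  exact Real.sqrt_le_sqrt (Finset.single_le_sum (f := fun α => L2sq (pderiv3 α f))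
    (fun α _ => L2sq_nonneg _) (listIndex_mem h))

theorem HN_pdList_le (hf : Tame f) (N : ℕ) (w : List (Fin 3)) :
    HN N (pdList w f) ≤ ((N : ℝ) + 1) ^ 3 * HN (w.length + N) f := by
  refine HN_le fun v hv => ?_
  rw [← pdList_append]
  exact hf.L2norm_pdList_le_HN (by rw [List.length_append]; omega)

/-- Interpolation between consecutive Sobolev norms. -/
theorem HN_sq_le (hf : Tame f) (N : ℕ) :
    HN (N + 1) f ^ 2 ≤ (((N : ℝ) + 2) ^ 3) ^ 2 * (HN N f * HN (N + 2) f) := by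
  have h₀ := mul_nonneg (HN_nonneg N f) (HN_nonneg (N + 2) f)
  have key : HN (N + 1) f ≤ (((N + 1 : ℕ) : ℝ) + 1) ^ 3 * √(HN N f * HN (N + 2) f) := by
    refine HN_le fun w hw => Real.le_sqrt_of_sq_le ?_
    rcases hw.lt_or_eq with hw | hw
    · rw [sq]
      exact mul_le_mul (hf.L2norm_pdList_le_HN (by omega)) (hf.L2norm_pdList_le_HN (by omega))
        (L2norm_nonneg _) (HN_nonneg _ _)
    · obtain ⟨i, v, rfl⟩ := List.exists_cons_of_length_eq_add_one hw
      rw [List.length_cons] at hw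
      rw [pdList, hf.smooth.pdList_pd]
      refine ((hf.pdList v).L2norm_pd_sq_le i).trans ?_
      refine mul_le_mul (hf.L2norm_pdList_le_HN (by omega)) ?_ (L2norm_nonneg _) (HN_nonneg _ _)
      rw [← hf.smooth.pdList_pd, ← (hf.smooth.pd i).pdList_pd]
      exact hf.L2norm_pdList_le_HN (w := i :: i :: v) (by simp only [List.length_cons]; omega)
  calc HN (N + 1) f ^ 2
      ≤ ((((N + 1 : ℕ) : ℝ) + 1) ^ 3 * √(HN N f * HN (N + 2) f)) ^ 2 := by
        gcongr
        exact HN_nonneg _ _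
    _ = _ := by
        rw [mul_pow, Real.sq_sqrt h₀]
        push_cast
        ring

theorem HN_mul_HN_le (hf : Tame f) (hg : Tame g) {n i j : ℕ} (h : i + j ≤ n) :
    HN i f * HN j g ≤
      (((n : ℝ) + 1) ^ 6) ^ n ^ 2 * (HN 0 f * HN n g + HN n f * HN 0 g) := by
  have key := le_of_almost_log_convex (a := fun i => HN i f * HN (n - i) g)
    (fun i => mul_nonneg (HN_nonneg _ _) (HN_nonneg _ _)) (n := n) (L := ((n : ℝ) + 1) ^ 6)
    (one_le_pow₀ (by linarith [n.cast_nonneg (α := ℝ)])) (fun i hi => ?_) (i := i) (by omega)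
  · simp only [Nat.sub_zero, Nat.sub_self] at key
    exact (mul_le_mul_of_nonneg_left (HN_mono (by omega) g) (HN_nonneg _ _)).trans key
  · obtain ⟨m, rfl⟩ := Nat.exists_eq_add_of_le hi
    have e₁ : i + 2 + m - i = m + 2 := by omega
    have e₂ : i + 2 + m - (i + 1) = m + 1 := by omega
    have e₃ : i + 2 + m - (i + 2) = m := by omega
    simp only [e₁, e₂, e₃]
    have hf₀ := mul_nonneg (HN_nonneg i f) (HN_nonneg (i + 2) f)
    have hg₀ := mul_nonneg (HN_nonneg m g) (HN_nonneg (m + 2) g)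
    calc (HN (i + 1) f * HN (m + 1) g) ^ 2 = HN (i + 1) f ^ 2 * HN (m + 1) g ^ 2 := mul_pow _ _ _
      _ ≤ ((((i : ℝ) + 2) ^ 3) ^ 2 * (HN i f * HN (i + 2) f)) *
            ((((m : ℝ) + 2) ^ 3) ^ 2 * (HN m g * HN (m + 2) g)) :=
          mul_le_mul (hf.HN_sq_le i) (hg.HN_sq_le m) (sq_nonneg _) (by positivity)
      _ ≤ (((((i + 2 + m : ℕ) : ℝ) + 1) ^ 3) ^ 2 * (HN i f * HN (i + 2) f)) *
            (((((i + 2 + m : ℕ) : ℝ) + 1) ^ 3) ^ 2 * (HN m g * HN (m + 2) g)) := by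
          have hi0 : (0 : ℝ) ≤ i := i.cast_nonneg
          have hm0 : (0 : ℝ) ≤ m := m.cast_nonneg
          have hi' : (i : ℝ) + 2 ≤ ((i + 2 + m : ℕ) : ℝ) + 1 := by push_cast; linarith
          have hm' : (m : ℝ) + 2 ≤ ((i + 2 + m : ℕ) : ℝ) + 1 := by push_cast; linarith
          generalize ((i + 2 + m : ℕ) : ℝ) + 1 = K at hi' hm' ⊢
          gcongr
      _ = _ := by ring

/-- The anisotropic product estimate in `L²`. -/
theorem L2norm_mul_le (hf : Tame f) (hg : Tame g) {i : Fin 3} (hi : i = 0 ∨ i = 2) :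
    L2norm (f * g) ≤ 2 * ((HN 1 (pd i f) + HN 1 f) * L2norm g +
      (L2norm (pd i f) + L2norm f) * HN 1 g) := by
  obtain ⟨k, hik⟩ : ∃ k : Fin 3, i = 0 ∧ k = 2 ∨ i = 2 ∧ k = 0 := by
    rcases hi with rfl | rfl
    exacts [⟨2, .inl ⟨rfl, rfl⟩⟩, ⟨0, .inr ⟨rfl, rfl⟩⟩]
  have h := hf.L2norm_mul_pow_le hg hik
  have hc : L2norm (pd 1 f) ≤ HN 1 f := hf.L2norm_pdList_le_HN (w := [1]) le_rfl
  have hd : L2norm (pd i (pd 1 f)) ≤ HN 1 (pd i f) := by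
    rw [hf.smooth.pd_comm]
    exact (hf.pd i).L2norm_pdList_le_HN (w := [1]) le_rfl
  have he : L2norm g ≤ HN 1 g := hg.L2norm_pdList_le_HN (w := []) (Nat.zero_le _)
  have hk : L2norm (pd k g) ≤ HN 1 g := hg.L2norm_pdList_le_HN (w := [k]) le_rfl
  have ha₀ := L2norm_nonneg f
  have hb₀ := L2norm_nonneg (pd i f)
  have hc₀ := L2norm_nonneg (pd 1 f)
  have hd₀ := L2norm_nonneg (pd i (pd 1 f))
  have he₀ := L2norm_nonneg g
  have hk₀ := L2norm_nonneg (pd k g)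
  have hH₀ := HN_nonneg 1 g
  set T := L2norm (pd i f) + L2norm f with hT
  set S := HN 1 (pd i f) + HN 1 f with hS
  have hT₀ : 0 ≤ T := by positivity
  have hS₀ : 0 ≤ S := by linarith
  have h₁ : 2 * L2norm f ^ 2 + L2norm (pd i f) ^ 2 ≤ 2 * T ^ 2 := by
    nlinarith [mul_nonneg ha₀ hb₀]
  have h₂ : 2 * L2norm (pd 1 f) ^ 2 + L2norm (pd i (pd 1 f)) ^ 2 ≤ 2 * S ^ 2 := by
    have : L2norm (pd 1 f) + L2norm (pd i (pd 1 f)) ≤ S := by linarith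
    nlinarith [mul_nonneg hc₀ hd₀]
  have h₃ : L2norm g ^ 2 + 2 * L2norm g * L2norm (pd k g) ≤ 3 * (L2norm g * HN 1 g) := by
    nlinarith
  have h₄ : (L2norm (f * g) ^ 2) ^ 2 ≤ (12 * ((S * L2norm g) * (T * HN 1 g))) ^ 2 := by
    calc (L2norm (f * g) ^ 2) ^ 2 = L2norm (f * g) ^ 4 := by ring
      _ ≤ _ := h
      _ ≤ 4 * (2 * T ^ 2) * (2 * S ^ 2) * (3 * (L2norm g * HN 1 g)) ^ 2 := by gcongr
      _ = _ := by ring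
  have h₅ := le_of_sq_le_sq h₄ (by positivity)
  refine le_of_sq_le_sq ?_ (by positivity)
  nlinarith [sq_nonneg (S * L2norm g - T * HN 1 g)]

theorem L2norm_pd_mul_le (hf : Tame f) (hg : Tame g) {i : Fin 3} (hi : i = 0 ∨ i = 2) :
    L2norm (pd i (f * g)) ≤ 8 * ((HN 1 (pd i f) + HN 1 f) * (L2norm (pd i g) + L2norm g) +
      (L2norm (pd i f) + L2norm f) * (HN 1 (pd i g) + HN 1 g)) := by
  rw [hf.smooth.pd_mul hg.smooth, mul_comm (pd i f) g]
  have h₀ := (hg.mul (hf.pd i)).L2norm_add_le (hf.mul (hg.pd i))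
  have h₁ := hg.L2norm_mul_le (hf.pd i) hi
  have h₂ := hf.L2norm_mul_le (hg.pd i) hi
  have a₁ := L2norm_nonneg f
  have a₂ := L2norm_nonneg (pd i f)
  have a₃ := L2norm_nonneg g
  have a₄ := L2norm_nonneg (pd i g)
  have b₁ := HN_nonneg 1 f
  have b₂ := HN_nonneg 1 (pd i f)
  have b₃ := HN_nonneg 1 g
  have b₄ := HN_nonneg 1 (pd i g)
  have c₁ : (HN 1 (pd i g) + HN 1 g) * L2norm (pd i f) ≤
    (L2norm (pd i f) + L2norm f) * (HN 1 (pd i g) + HN 1 g) := by nlinarith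
  have c₂ : (L2norm (pd i g) + L2norm g) * HN 1 (pd i f) ≤
    (HN 1 (pd i f) + HN 1 f) * (L2norm (pd i g) + L2norm g) := by nlinarith
  have c₃ : (HN 1 (pd i f) + HN 1 f) * L2norm (pd i g) ≤
    (HN 1 (pd i f) + HN 1 f) * (L2norm (pd i g) + L2norm g) := by gcongr; linarith
  have c₄ : (L2norm (pd i f) + L2norm f) * HN 1 (pd i g) ≤
    (L2norm (pd i f) + L2norm f) * (HN 1 (pd i g) + HN 1 g) := by gcongr; linarith
  linarith

/-- Leibniz' rule: derivatives of a product are controlled by products of derivatives. -/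
theorem L2norm_pdList_mul_le (hf : Tame f) (hg : Tame g) (w : List (Fin 3)) {M : ℝ}
    (h : ∀ s t : List (Fin 3), s.length + t.length = w.length →
      L2norm (pdList s f * pdList t g) ≤ M) :
    L2norm (pdList w (f * g)) ≤ 4 ^ w.length * M := by
  induction w generalizing f g with
  | nil =>
    rw [List.length_nil, pow_zero, one_mul]
    exact h [] [] rfl
  | cons i w ih =>
    have h₁ := ih (hf.pd i) hg fun s t hst =>
      h (i :: s) t (by simp only [List.length_cons]; omega)
    have h₂ := ih hf (hg.pd i) fun s t hst =>
      h s (i :: t) (by simp only [List.length_cons]; omega)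
    rw [pdList, hf.smooth.pd_mul hg.smooth, ((hf.smooth.pd i).mul hg.smooth).pdList_add
      (hf.smooth.mul (hg.smooth.pd i)), List.length_cons, pow_succ]
    have h₃ := (((hf.pd i).mul hg).pdList w).L2norm_add_le ((hf.mul (hg.pd i)).pdList w)
    linarith

theorem HN_le_of_mean_zero (hf : Tame f)
    (h0 : ∀ y z : ℝ, (∫ x in Set.Ioc (0:ℝ) 1, f x y z) = 0) (N : ℕ) :
    HN N f ≤ ((N : ℝ) + 1) ^ 3 * HN N (pd 0 f) := by
  refine HN_le fun w hw => ?_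
  refine ((hf.pdList w).L2norm_le_of_mean_zero (hf.mean_zero_pdList h0 w)).trans ?_
  rw [← hf.smooth.pdList_pd]
  exact (hf.pd 0).L2norm_pdList_le_HN hw

theorem L2norm_pdList_mul_pdList_le (hf : Tame f) (hg : Tame g)
    (h0 : ∀ y z : ℝ, (∫ x in Set.Ioc (0:ℝ) 1, f x y z) = 0) (s t : List (Fin 3)) :
    L2norm (pdList s f * pdList t g) ≤
      144 * (HN (s.length + 1) (pd 0 f) * HN t.length g +
        HN s.length (pd 0 f) * HN (t.length + 1) g) := by
  have h := (hf.pdList s).L2norm_mul_le (hg.pdList t) (.inl rfl)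
  have h₁ := (hf.pdList s).HN_le_of_mean_zero (hf.mean_zero_pdList h0 s) 1
  have h₂ := (hf.pdList s).L2norm_le_of_mean_zero (hf.mean_zero_pdList h0 s)
  rw [← hf.smooth.pdList_pd] at h h₁ h₂
  have h₃ := (hf.pd 0).HN_pdList_le 1 s
  have h₄ := hg.HN_pdList_le 1 t
  have h₅ := (hf.pd 0).L2norm_pdList_le_HN (le_refl s.length)
  have h₆ := hg.L2norm_pdList_le_HN (le_refl t.length)
  norm_num at h₁ h₃ h₄
  have b₁ := HN_nonneg (s.length + 1) (pd 0 f)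
  have b₂ := HN_nonneg s.length (pd 0 f)
  calc _ ≤ _ := h
    _ ≤ 2 * ((72 * HN (s.length + 1) (pd 0 f)) * HN t.length g +
          (2 * HN s.length (pd 0 f)) * (8 * HN (t.length + 1) g)) := by
        gcongr
        · exact L2norm_nonneg _
        · linarith
        · exact HN_nonneg _ _
        · linarith
    _ ≤ _ := by
        nlinarith [mul_nonneg b₂ (HN_nonneg (t.length + 1) g)]

theorem HN_mul_le (hf : Tame f) (hg : Tame g)
    (h0 : ∀ y z : ℝ, (∫ x in Set.Ioc (0:ℝ) 1, f x y z) = 0) (k : ℕ) :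
    HN k (f * g) ≤
      ((k : ℝ) + 1) ^ 3 * (4 ^ k * (288 * ((((k + 1 : ℕ) : ℝ) + 1) ^ 6) ^ (k + 1) ^ 2)) *
      (HN 0 (pd 0 f) * HN (k + 1) g + HN (k + 1) (pd 0 f) * HN 0 g) := by
  set Q := HN 0 (pd 0 f) * HN (k + 1) g + HN (k + 1) (pd 0 f) * HN 0 g with hQ
  have hQ₀ : 0 ≤ Q := add_nonneg (mul_nonneg (HN_nonneg _ _) (HN_nonneg _ _))
    (mul_nonneg (HN_nonneg _ _) (HN_nonneg _ _))
  rw [mul_assoc]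
  refine HN_le fun w hw => ?_
  have h := hf.L2norm_pdList_mul_le hg w
    (M := 288 * ((((k + 1 : ℕ) : ℝ) + 1) ^ 6) ^ (k + 1) ^ 2 * Q) fun s t hst => by
      have h₁ := (hf.pd 0).HN_mul_HN_le hg (n := k + 1) (i := s.length + 1) (j := t.length)
        (by omega)
      have h₂ := (hf.pd 0).HN_mul_HN_le hg (n := k + 1) (i := s.length) (j := t.length + 1)
        (by omega)
      rw [← hQ] at h₁ h₂
      refine (hf.L2norm_pdList_mul_pdList_le hg h0 s t).trans ?_
      linarith
  refine h.trans ?_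
  rw [mul_assoc (4 ^ k)]
  gcongr
  norm_num

end Tame

theorem HN_zero (f : ℝ → ℝ → ℝ → ℂ) : HN 0 f = L2norm f := by
  have : multiIndicesLe 0 = {(0, 0, 0)} := by decide
  simp [HN, HNsq, this, L2norm, pderiv3]

/-- For `∂_j ∈ {∂_x, ∂_z}`:
(i) `‖f₁ f₂‖_{L²} ≤ C(‖∂_j f₁‖_{H¹} + ‖f₁‖_{H¹})‖f₂‖_{L²} + C(‖∂_j f₁‖_{L²} + ‖f₁‖_{L²})‖f₂‖_{H¹}`;
(ii) `‖∂_j(f₁ f₂)‖_{L²} ≤ C(‖∂_j f₁‖_{H¹} + ‖f₁‖_{H¹})(‖∂_j f₂‖_{L²} + ‖f₂‖_{L²})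
      + C(‖∂_j f₁‖_{L²} + ‖f₁‖_{L²})(‖∂_j f₂‖_{H¹} + ‖f₂‖_{H¹})`;
(iii) if `P₀ f₁ = 0`, for `k ∈ {1,2,3}`:
`‖f₁ f₂‖_{H^k} ≤ C‖∂_x f₁‖_{H^{k+1}}‖f₂‖_{L²} + C‖∂_x f₁‖_{L²}‖f₂‖_{H^{k+1}}`. -/
theorem stmt16 : ∃ C : ℝ, 0 < C ∧ ∀ f₁ f₂ : ℝ → ℝ → ℝ → ℂ,
    GoodFn f₁ → GoodFn f₂ →
    (∀ D : (ℝ → ℝ → ℝ → ℂ) → (ℝ → ℝ → ℝ → ℂ), (D = pdx ∨ D = pdz) →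
      L2norm (fun x y z => f₁ x y z * f₂ x y z)
        ≤ C * (HN 1 (D f₁) + HN 1 f₁) * L2norm f₂
          + C * (L2norm (D f₁) + L2norm f₁) * HN 1 f₂ ∧
      L2norm (D (fun x y z => f₁ x y z * f₂ x y z))
        ≤ C * (HN 1 (D f₁) + HN 1 f₁) * (L2norm (D f₂) + L2norm f₂)
          + C * (L2norm (D f₁) + L2norm f₁) * (HN 1 (D f₂) + HN 1 f₂)) ∧
    ((∀ y z : ℝ, (∫ x in Set.Ioc (0:ℝ) 1, f₁ x y z) = 0) →
      ∀ k : ℕ, 1 ≤ k → k ≤ 3 →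
        HN k (fun x y z => f₁ x y z * f₂ x y z)
          ≤ C * HN (k+1) (pdx f₁) * L2norm f₂
            + C * L2norm (pdx f₁) * HN (k+1) f₂) := by
  let c : ℕ → ℝ := fun k =>
    ((k : ℝ) + 1) ^ 3 * (4 ^ k * (288 * ((((k + 1 : ℕ) : ℝ) + 1) ^ 6) ^ (k + 1) ^ 2))
  have hc : ∀ k, 0 ≤ c k := fun k => by positivity
  have hsum : 0 ≤ ∑ k ∈ Finset.range 4, c k := Finset.sum_nonneg fun k _ => hc k
  refine ⟨8 + ∑ k ∈ Finset.range 4, c k, by positivity, fun f₁ f₂ h₁ h₂ => ⟨?_, ?_⟩⟩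
  · intro D hD
    obtain ⟨i, hi, rfl⟩ : ∃ i : Fin 3, (i = 0 ∨ i = 2) ∧ D = pd i := by
      rcases hD with rfl | rfl
      exacts [⟨0, .inl rfl, rfl⟩, ⟨2, .inr rfl, rfl⟩]
    have a₁ := L2norm_nonneg f₁
    have a₂ := L2norm_nonneg (pd i f₁)
    have a₃ := L2norm_nonneg f₂
    have a₄ := L2norm_nonneg (pd i f₂)
    have b₁ := HN_nonneg 1 f₁
    have b₂ := HN_nonneg 1 (pd i f₁)
    have b₃ := HN_nonneg 1 f₂
    have b₄ := HN_nonneg 1 (pd i f₂)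
    constructor
    · refine (h₁.tame.L2norm_mul_le h₂.tame hi).trans ?_
      rw [mul_assoc, mul_assoc, ← mul_add]
      gcongr
      linarith
    · refine (h₁.tame.L2norm_pd_mul_le h₂.tame hi).trans ?_
      rw [mul_assoc, mul_assoc, ← mul_add]
      gcongr
      linarith
  · intro h0 k _ hk
    have hle : c k ≤ 8 + ∑ k ∈ Finset.range 4, c k := by
      have := Finset.single_le_sum (fun k _ => hc k)
        (Finset.mem_range.mpr (show k < 4 by omega))
      linarith
    have h := h₁.tame.HN_mul_le h₂.tame h0 k
    rw [HN_zero, HN_zero, add_comm (L2norm _ * _)] at h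
    refine h.trans ?_
    rw [mul_assoc (8 + _), mul_assoc (8 + _), ← mul_add]
    refine mul_le_mul_of_nonneg_right hle ?_
    exact add_nonneg (mul_nonneg (HN_nonneg _ _) (L2norm_nonneg _))
      (mul_nonneg (L2norm_nonneg _) (HN_nonneg _ _))

end
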